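/- arXiv:math/0010163 — 3 statements merged into one kernel-verified Lean document; each statement's English description precedes it below -/
import Mathlib

section
/- Every surface of degree 5 in ℙ³(ℂ) whose only singularities are ν ordinary triple points satisfies ν ≤ 5, and there exists a quintic surface in ℙ³(ℂ) whose only singularities are exactly 5 ordinary triple points. Hence μ₃(5) = 5. -/
open MvPolynomial

noncomputable section

/-- Iterated partial derivative of `f` along a list of variable indices. -/
def pderivList {n : ℕ} (l : List (Fin n)) (f : MvPolynomial (Fin n) ℂ) :
    MvPolynomial (Fin n) ℂ :=
  l.foldl (fun g i => MvPolynomial.pderiv i g) f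

/-- All partial derivatives of `f` of order `< m` vanish at `p`
(`P` has multiplicity `≥ m` on `{f = 0}`). -/
def MultAtLeast {n : ℕ} (f : MvPolynomial (Fin n) ℂ) (p : Fin n → ℂ) (m : ℕ) : Prop :=
  ∀ l : List (Fin n), l.length < m → MvPolynomial.eval p (pderivList l f) = 0

/-- `p` is (a representative of) a singular point of `{f = 0}`. -/
def SingularAt (f : MvPolynomial (Fin 4) ℂ) (p : Fin 4 → ℂ) : Prop :=
  MultAtLeast f p 2

/-- The partial derivatives of `c` have no common zero in `ℂⁿ ∖ {0}`. -/
def NowhereSingular {n : ℕ} (c : MvPolynomial (Fin n) ℂ) : Prop :=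
  ∀ p : Fin n → ℂ, p ≠ 0 → ∃ i, MvPolynomial.eval p (MvPolynomial.pderiv i c) ≠ 0

/-- Linear change of coordinates: `substMatrix B f` is the polynomial `x ↦ f (B.mulVec x)`. -/
def substMatrix {n : ℕ} (B : Matrix (Fin n) (Fin n) ℂ) (f : MvPolynomial (Fin n) ℂ) :
    MvPolynomial (Fin n) ℂ :=
  MvPolynomial.aeval (fun i => ∑ j, MvPolynomial.C (B i j) * MvPolynomial.X j) f

/-- `p` is (a representative of) an ordinary triple point of the degree-`d` surface `{f = 0}`:
all partials of order `≤ 2` vanish at `p`, some third-order partial does not, and after a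
linear change of coordinates taking `(0,0,0,1)` to `p`, writing `f` as
`∑ⱼ x₃^(d-j) fⱼ(x₀,x₁,x₂)` with `fⱼ` homogeneous of degree `j`, the cubic `f₃` is nonsingular. -/
def OrdinaryTriplePointAt (d : ℕ) (f : MvPolynomial (Fin 4) ℂ) (p : Fin 4 → ℂ) : Prop :=
  MultAtLeast f p 3 ∧
  (∃ l : List (Fin 4), l.length = 3 ∧ MvPolynomial.eval p (pderivList l f) ≠ 0) ∧
  ∃ B : Matrix (Fin 4) (Fin 4) ℂ, IsUnit B.det ∧ B.mulVec ![0, 0, 0, 1] = p ∧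
    ∃ g : ℕ → MvPolynomial (Fin 3) ℂ,
      (∀ j, (g j).IsHomogeneous j) ∧
      substMatrix B f =
        ∑ j ∈ Finset.range (d + 1),
          (MvPolynomial.X 3) ^ (d - j) * MvPolynomial.rename Fin.castSucc (g j) ∧
      NowhereSingular (g 3)

/-- The set of singular points of `{f = 0}` in `ℙ³(ℂ)`. -/
def SingSet (f : MvPolynomial (Fin 4) ℂ) : Set (Projectivization ℂ (Fin 4 → ℂ)) :=
  {P | SingularAt f P.rep}

/-- `{f = 0}` has `ν` ordinary triple points as its only singularities. -/
def OnlyTriplePoints (d ν : ℕ) (f : MvPolynomial (Fin 4) ℂ) : Prop :=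
  (SingSet f).Finite ∧ (SingSet f).ncard = ν ∧
  ∀ P ∈ SingSet f, OrdinaryTriplePointAt d f P.rep

/-- The directional derivative of a polynomial, linear in the direction. -/
def dirDeriv {n : ℕ} : (Fin n → ℂ) →ₗ[ℂ] Module.End ℂ (MvPolynomial (Fin n) ℂ) :=
  ∑ i, (LinearMap.proj i).smulRight (pderiv (R := ℂ) i).toLinearMap

theorem dirDeriv_apply {n : ℕ} (v : Fin n → ℂ) (f : MvPolynomial (Fin n) ℂ) :
    dirDeriv v f = ∑ i, v i • pderiv i f := by
  simp [dirDeriv]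

theorem dirDeriv_single {n : ℕ} (i : Fin n) (f : MvPolynomial (Fin n) ℂ) :
    dirDeriv (Pi.single i 1) f = pderiv i f := by
  simp [dirDeriv_apply, Pi.single_apply, ite_smul]

theorem pderiv_comm_apply {n : ℕ} (i j : Fin n) (f : MvPolynomial (Fin n) ℂ) :
    pderiv i (pderiv j f) = pderiv j (pderiv i f) := by
  have h : ⁅(pderiv (R := ℂ) i), pderiv (R := ℂ) j⁆ = 0 := by
    refine MvPolynomial.derivation_ext fun k => ?_
    simp [Derivation.commutator_apply, pderiv_X, Pi.single_apply, apply_ite]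
  have := congrArg (fun D => D f) h
  simpa [Derivation.commutator_apply, sub_eq_zero] using this

theorem dirDeriv_comm {n : ℕ} (v w : Fin n → ℂ) (f : MvPolynomial (Fin n) ℂ) :
    dirDeriv v (dirDeriv w f) = dirDeriv w (dirDeriv v f) := by
  simp only [dirDeriv_apply, map_sum, Derivation.map_smul, smul_smul]
  rw [Finset.sum_comm]
  refine Finset.sum_congr rfl fun i _ => Finset.sum_congr rfl fun j _ => ?_
  rw [pderiv_comm_apply, mul_comm]

theorem isHomogeneous_dirDeriv {n k : ℕ} {f : MvPolynomial (Fin n) ℂ} (hf : f.IsHomogeneous k)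
    (v : Fin n → ℂ) : (dirDeriv v f).IsHomogeneous (k - 1) := by
  rw [dirDeriv_apply]
  refine IsHomogeneous.sum _ _ _ fun i _ => ?_
  rw [smul_eq_C_mul]
  exact hf.pderiv.C_mul _

theorem eval_dirDeriv_self {n k : ℕ} {f : MvPolynomial (Fin n) ℂ} (hf : f.IsHomogeneous k)
    (v : Fin n → ℂ) : eval v (dirDeriv v f) = k * eval v f := by
  have := congrArg (eval v) hf.sum_X_mul_pderiv
  simpa [dirDeriv_apply, smul_eval] using this

theorem eval_eq_of_isHomogeneous_zero {n : ℕ} {f : MvPolynomial (Fin n) ℂ}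
    (hf : f.IsHomogeneous 0) (v w : Fin n → ℂ) : eval v f = eval w f := by
  rw [totalDegree_eq_zero_iff_eq_C.1 ((totalDegree_zero_iff_isHomogeneous _).2 hf)]
  simp

/-- The polar form of a quintic: the symmetric 5-linear form given by fivefold
directional derivatives. -/
def polarForm {n : ℕ} (f : MvPolynomial (Fin n) ℂ) (a b c d e : Fin n → ℂ) : ℂ :=
  eval 0 (dirDeriv a (dirDeriv b (dirDeriv c (dirDeriv d (dirDeriv e f)))))

theorem polarForm_eq_two_mul_eval {n : ℕ} {f : MvPolynomial (Fin n) ℂ} (hf : f.IsHomogeneous 5)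
    (v c d e : Fin n → ℂ) :
    polarForm f v v c d e = 2 * eval v (dirDeriv c (dirDeriv d (dirDeriv e f))) := by
  have h2 : (dirDeriv c (dirDeriv d (dirDeriv e f))).IsHomogeneous 2 :=
    isHomogeneous_dirDeriv (isHomogeneous_dirDeriv (isHomogeneous_dirDeriv hf e) d) c
  have h1 := isHomogeneous_dirDeriv h2 v
  have h0 := isHomogeneous_dirDeriv h1 v
  rw [polarForm, eval_eq_of_isHomogeneous_zero h0 0 v, eval_dirDeriv_self h1,
    eval_dirDeriv_self h2]
  norm_num

theorem polarForm_eq_zero_of_multAtLeast {n : ℕ} {f : MvPolynomial (Fin n) ℂ}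
    (hf : f.IsHomogeneous 5) {p : Fin n → ℂ} (hp : MultAtLeast f p 3) (a b : Fin n → ℂ) :
    polarForm f p p p a b = 0 := by
  have h3 : (dirDeriv a (dirDeriv b f)).IsHomogeneous 3 :=
    isHomogeneous_dirDeriv (isHomogeneous_dirDeriv hf b) a
  rw [polarForm_eq_two_mul_eval hf, eval_dirDeriv_self h3]
  have h (i j : Fin n) : eval p (pderiv i (pderiv j f)) = 0 := hp [j, i] (by simp)
  simp [dirDeriv_apply, smul_eval, h]

theorem dirDeriv_mul {n : ℕ} (v : Fin n → ℂ) (f g : MvPolynomial (Fin n) ℂ) :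
    dirDeriv v (f * g) = f * dirDeriv v g + g * dirDeriv v f := by
  simp [dirDeriv_apply, Finset.mul_sum, Finset.sum_add_distrib]

theorem dirDeriv_X {n : ℕ} (v : Fin n → ℂ) (i : Fin n) :
    dirDeriv v (X i) = C (v i) := by
  simp [dirDeriv_apply, pderiv_X, Pi.single_apply, smul_eq_C_mul]

theorem dirDeriv_C {n : ℕ} (v : Fin n → ℂ) (c : ℂ) : dirDeriv v (C c) = 0 := by
  simp [dirDeriv_apply]

theorem dirDeriv_substMatrix {n : ℕ} (B : Matrix (Fin n) (Fin n) ℂ) (w : Fin n → ℂ)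
    (f : MvPolynomial (Fin n) ℂ) :
    dirDeriv w (substMatrix B f) = substMatrix B (dirDeriv (B.mulVec w) f) := by
  induction f using MvPolynomial.induction_on with
  | C a => simp [substMatrix, dirDeriv_C, algebraMap_eq]
  | add p q hp hq => simp_all [substMatrix]
  | mul_X p i hp =>
    simp only [substMatrix, map_mul, map_add, dirDeriv_mul, aeval_X, dirDeriv_X] at hp ⊢
    rw [hp]
    simp [dirDeriv_mul, dirDeriv_X, dirDeriv_C, Matrix.mulVec, dotProduct, algebraMap_eq]

theorem eval_substMatrix {n : ℕ} (B : Matrix (Fin n) (Fin n) ℂ) (w : Fin n → ℂ)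
    (f : MvPolynomial (Fin n) ℂ) :
    eval w (substMatrix B f) = eval (B.mulVec w) f := by
  induction f using MvPolynomial.induction_on with
  | C a => simp [substMatrix, algebraMap_eq]
  | add p q hp hq => simp_all [substMatrix]
  | mul_X p i hp =>
    simp only [substMatrix, map_mul, aeval_X] at hp ⊢
    rw [hp]
    simp [Matrix.mulVec, dotProduct]

theorem pderiv_last_rename (g : MvPolynomial (Fin 3) ℂ) :
    pderiv (3 : Fin 4) (rename Fin.castSucc g) = 0 := by
  refine pderiv_eq_zero_of_notMem_vars fun h => ?_
  classical
  obtain ⟨i, -, hi⟩ := Finset.mem_image.1 (vars_rename _ g h)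
  exact (Fin.castSucc_lt_last i).ne hi

theorem exists_eq_smul_of_ordinaryTriplePointAt {f : MvPolynomial (Fin 4) ℂ}
    (hf : f.IsHomogeneous 5) {p : Fin 4 → ℂ} (hp : OrdinaryTriplePointAt 5 f p)
    (v : Fin 4 → ℂ) (hv : ∀ w, polarForm f p p v v w = 0) : ∃ c : ℂ, v = c • p := by
  obtain ⟨hm, -, B, hB, hBp, g, -, hg, hns⟩ := hp
  have he : (![0, 0, 0, 1] : Fin 4 → ℂ) = Pi.single 3 1 := by
    ext i; fin_cases i <;> rfl
  rw [he] at hBp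
  set w := B⁻¹.mulVec v with hw
  have hBw : B.mulVec w = v := by
    rw [hw, Matrix.mulVec_mulVec, Matrix.mul_nonsing_inv _ hB, Matrix.one_mulVec]
  set w₀ := w - w 3 • Pi.single 3 1 with hw₀
  have hBw₀ : B.mulVec w₀ = v - w 3 • p := by
    rw [hw₀, Matrix.mulVec_sub, Matrix.mulVec_smul, hBw, hBp]
  have hw3 : w₀ 3 = 0 := by simp [hw₀]
  have hpoly (i : Fin 3) : eval (w₀ ∘ Fin.castSucc) (pderiv i (g 3)) = 0 := by
    have h1 := hv (B.mulVec (Pi.single i.castSucc 1))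
    have h2 : polarForm f (B.mulVec w₀) (B.mulVec w₀) (B.mulVec (Pi.single i.castSucc 1)) p p
        = 0 := by
      have h3 (a b) := polarForm_eq_zero_of_multAtLeast hf hm a b
      rw [hBw₀]
      simp only [polarForm, map_sub, map_smul, LinearMap.sub_apply, LinearMap.smul_apply,
        smul_eval] at h1 h3 ⊢
      generalize B.mulVec (Pi.single i.castSucc 1) = b at h1 ⊢
      have e1 := h3 v b
      have e2 := h3 p b
      simp only [dirDeriv_comm] at h1 e1 e2 ⊢
      linear_combination h1 - 2 * w 3 * e1 + w 3 ^ 2 * e2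
    rw [polarForm_eq_two_mul_eval hf, ← hBp, ← eval_substMatrix, ← dirDeriv_substMatrix,
      ← dirDeriv_substMatrix, ← dirDeriv_substMatrix, hg] at h2
    have hs : (Pi.single i.castSucc 1 : Fin 4 → MvPolynomial (Fin 4) ℂ) 3 = 0 :=
      Pi.single_eq_of_ne (Fin.castSucc_lt_last i).ne' _
    have h2' (j : Fin 4) : pderiv j (2 : MvPolynomial (Fin 4) ℂ) = 0 := (pderiv j).map_natCast 2
    simpa [hs, h2', Finset.sum_range_succ, dirDeriv_single, pderiv_last_rename, pderiv_X, hw3,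
      eval_rename,
      pderiv_rename (Fin.castSucc_injective 3)] using h2
  have hz : w₀ ∘ Fin.castSucc = 0 := by
    by_contra hne
    obtain ⟨i, hi⟩ := hns _ hne
    exact hi (hpoly i)
  have hz' : w₀ = 0 := by
    ext i
    refine Fin.lastCases hw3 (fun j => congrFun hz j) i
  refine ⟨w 3, ?_⟩
  rw [hz', Matrix.mulVec_zero] at hBw₀
  exact (sub_eq_zero.1 hBw₀.symm)

/-- Coordinate-free form of a triple point of a quintic. -/
def IsPolarTriple {n : ℕ} (f : MvPolynomial (Fin n) ℂ) (p : Fin n → ℂ) : Prop :=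
  ∀ a b, polarForm f p p p a b = 0

theorem IsPolarTriple.eval_eq_zero {n : ℕ} {f : MvPolynomial (Fin n) ℂ} {p : Fin n → ℂ}
    (hp : IsPolarTriple f p) (a b : Fin n → ℂ) :
    eval 0 (dirDeriv p (dirDeriv p (dirDeriv p (dirDeriv a (dirDeriv b f))))) = 0 ∧
    eval 0 (dirDeriv a (dirDeriv p (dirDeriv p (dirDeriv p (dirDeriv b f))))) = 0 ∧
    eval 0 (dirDeriv a (dirDeriv b (dirDeriv p (dirDeriv p (dirDeriv p f))))) = 0 := by
  have h : eval 0 (dirDeriv p (dirDeriv p (dirDeriv p (dirDeriv a (dirDeriv b f))))) = 0 := hp a b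
  refine ⟨h, ?_, ?_⟩ <;> rw [← h] <;> congr 1 <;> simp only [dirDeriv_comm]

theorem IsPolarTriple.smul {n : ℕ} {f : MvPolynomial (Fin n) ℂ} {p : Fin n → ℂ}
    (hp : IsPolarTriple f p) (c : ℂ) : IsPolarTriple f (c • p) := by
  intro a b
  have h := (hp.eval_eq_zero a b).1
  simp only [polarForm, map_smul, LinearMap.smul_apply, smul_eval, h, mul_zero]

/-- Coordinate-free form of an ordinary triple point of a quintic: the tangent cone is
singular only at the vertex. -/
def IsPolarOrdinary {n : ℕ} (f : MvPolynomial (Fin n) ℂ) (p : Fin n → ℂ) : Prop :=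
  ∀ v, (∀ w, polarForm f p p v v w = 0) → ∃ c : ℂ, v = c • p

theorem polarForm_eq_zero_of_collinear {n : ℕ} {f : MvPolynomial (Fin n) ℂ}
    {p q : Fin n → ℂ} (hp : IsPolarTriple f p) (hq : IsPolarTriple f q) {α β : ℂ}
    (hα : α ≠ 0) (hβ : β ≠ 0) (hr : IsPolarTriple f (α • p + β • q)) (w : Fin n → ℂ) :
    polarForm f p p q q w = 0 := by
  have h := hr p w
  simp only [polarForm, map_add, map_smul, LinearMap.add_apply, LinearMap.smul_apply, smul_eval,
    dirDeriv_comm, (hp.eval_eq_zero _ _).1, (hq.eval_eq_zero _ _).2.1] at h ⊢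
  have hc : 3 * α * β ^ 2 ≠ 0 := mul_ne_zero (mul_ne_zero three_ne_zero hα) (pow_ne_zero 2 hβ)
  refine (mul_eq_zero.1 ?_).resolve_left hc
  linear_combination h

theorem polarForm_eq_zero_of_coplanar {n : ℕ} {f : MvPolynomial (Fin n) ℂ}
    {p q r : Fin n → ℂ} (hp : IsPolarTriple f p) (hq : IsPolarTriple f q)
    (hr : IsPolarTriple f r) {α β γ : ℂ} (hα : α ≠ 0) (hβ : β ≠ 0) (hγ : γ ≠ 0)
    (hs : IsPolarTriple f (α • p + β • q + γ • r)) :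
    polarForm f p p q q r = 0 ∧ polarForm f p p q r r = 0 ∧ polarForm f p q q r r = 0 := by
  have h1 := hs p p
  have h2 := hs q q
  have h3 := hs r r
  simp only [polarForm, map_add, map_smul, LinearMap.add_apply, LinearMap.smul_apply, smul_eval,
    dirDeriv_comm, (hp.eval_eq_zero _ _).1, (hq.eval_eq_zero _ _).1, (hr.eval_eq_zero _ _).1,
    (hq.eval_eq_zero _ _).2.1, (hr.eval_eq_zero _ _).2.1, (hq.eval_eq_zero _ _).2.2,
    (hr.eval_eq_zero _ _).2.2]
    at h1 h2 h3 ⊢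
  grind

theorem polarForm_sum_sq {n : ℕ} (f : MvPolynomial (Fin n) ℂ) (a b c d x y z : Fin n → ℂ) :
    polarForm f (a + b + c + d) (a + b + c + d) x y z =
      polarForm f a a x y z + polarForm f b b x y z + polarForm f c c x y z +
      polarForm f d d x y z + 2 * (polarForm f a b x y z + polarForm f a c x y z +
      polarForm f a d x y z + polarForm f b c x y z + polarForm f b d x y z +
      polarForm f c d x y z) := by
  simp only [polarForm, map_add, LinearMap.add_apply, dirDeriv_comm b a, dirDeriv_comm c a,
    dirDeriv_comm d a, dirDeriv_comm c b, dirDeriv_comm d b, dirDeriv_comm d c]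
  ring

theorem polarForm_sum_cube {n : ℕ} {f : MvPolynomial (Fin n) ℂ} {a b c d : Fin n → ℂ}
    (ha : IsPolarTriple f a) (hb : IsPolarTriple f b) (hc : IsPolarTriple f c)
    (hd : IsPolarTriple f d) (x y : Fin n → ℂ) :
    polarForm f (a + b + c + d) (a + b + c + d) (a + b + c + d) x y =
      3 * (polarForm f a a b x y + polarForm f a a c x y + polarForm f a a d x y +
        polarForm f a b b x y + polarForm f b b c x y + polarForm f b b d x y +
        polarForm f a c c x y + polarForm f b c c x y + polarForm f c c d x y +
        polarForm f a d d x y + polarForm f b d d x y + polarForm f c d d x y) +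
      6 * (polarForm f a b c x y + polarForm f a b d x y +
        polarForm f a c d x y + polarForm f b c d x y) := by
  have ha := ha x y
  have hb := hb x y
  have hc := hc x y
  have hd := hd x y
  rw [polarForm_sum_sq]
  simp only [polarForm, map_add, LinearMap.add_apply, dirDeriv_comm b a, dirDeriv_comm c a,
    dirDeriv_comm d a, dirDeriv_comm c b, dirDeriv_comm d b, dirDeriv_comm d c] at ha hb hc hd ⊢
  linear_combination ha + hb + hc + hd

theorem polarForm_sum_eq {n : ℕ} {f : MvPolynomial (Fin n) ℂ} {a b c d : Fin n → ℂ}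
    (ha : IsPolarTriple f a) (hb : IsPolarTriple f b) (hc : IsPolarTriple f c)
    (hd : IsPolarTriple f d) (hu : IsPolarTriple f (a + b + c + d)) :
    polarForm f (a + b + c + d) (a + b + c + d) a a b = -polarForm f b c c d d ∧
    polarForm f (a + b + c + d) (a + b + c + d) a b c = -polarForm f a b c d d := by
  have hcube (x y) := (polarForm_sum_cube ha hb hc hd x y).symm.trans (hu x y)
  have haa := hcube a a
  have hab := hcube a b
  have hac := hcube a c
  have had := hcube a d
  have hbb := hcube b b
  have hbc := hcube b c
  have hbd := hcube b d
  have hcc := hcube c c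
  have hcd := hcube c d
  have hdd := hcube d d
  rw [polarForm_sum_sq, polarForm_sum_sq]
  simp only [polarForm, dirDeriv_comm b a, dirDeriv_comm c a, dirDeriv_comm d a,
    dirDeriv_comm c b, dirDeriv_comm d b, dirDeriv_comm d c,
    (ha.eval_eq_zero _ _).1, (hb.eval_eq_zero _ _).1, (hb.eval_eq_zero _ _).2.1,
    (hb.eval_eq_zero _ _).2.2, (hc.eval_eq_zero _ _).1, (hc.eval_eq_zero _ _).2.1,
    (hc.eval_eq_zero _ _).2.2, (hd.eval_eq_zero _ _).2.1, (hd.eval_eq_zero _ _).2.2]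
    at haa hab hac had hbb hbc hbd hcc hcd hdd ⊢
  constructor
  · linear_combination (2/5) * haa + (3/10) * hab - (1/5) * hac - (1/5) * had - (1/10) * hbb -
      (1/30) * hbc - (1/30) * hbd + (1/15) * hcc + (2/15) * hcd + (1/15) * hdd
  · linear_combination (-1/5) * haa + (4/15) * hab + (4/15) * hac - (1/15) * had - (1/5) * hbb +
      (4/15) * hbc - (1/15) * hbd - (1/5) * hcc - (1/15) * hcd + (2/15) * hdd

theorem polarForm_swap_middle {n : ℕ} (f : MvPolynomial (Fin n) ℂ) (a b c d e : Fin n → ℂ) :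
    polarForm f a b d c e = polarForm f a b c d e := by
  rw [polarForm, dirDeriv_comm d c, polarForm]

theorem polarForm_swap_right {n : ℕ} (f : MvPolynomial (Fin n) ℂ) (a b c d e : Fin n → ℂ) :
    polarForm f a b c e d = polarForm f a b c d e := by
  rw [polarForm, dirDeriv_comm e d, polarForm]

theorem polarForm_smul {n : ℕ} (f : MvPolynomial (Fin n) ℂ) (a b c d e : Fin n → ℂ)
    (r s t : ℂ) : polarForm f a b (r • c) (s • d) (t • e) = r * s * t * polarForm f a b c d e := by
  simp only [polarForm, map_smul, LinearMap.smul_apply, smul_eval]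
  ring

theorem polarForm_smul_left {n : ℕ} (f : MvPolynomial (Fin n) ℂ) (a b c d e : Fin n → ℂ)
    (r s : ℂ) : polarForm f (r • a) (s • b) c d e = r * s * polarForm f a b c d e := by
  simp only [polarForm, map_smul, LinearMap.smul_apply, smul_eval]
  ring

/-- The effect on second-order contact of the standard Cremona transformation centred at four
triple points. -/
theorem polarForm_cremona {n : ℕ} {f : MvPolynomial (Fin n) ℂ} {e : Fin 4 → Fin n → ℂ}
    (he : ∀ i, IsPolarTriple f (e i)) {d : Fin 4 → ℂ} (hd : ∀ i, d i ≠ 0)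
    {u q : Fin n → ℂ} (hu : u = ∑ i, e i) (hq : q = ∑ i, (d i)⁻¹ • e i)
    (hut : IsPolarTriple f u) (hqt : IsPolarTriple f q) (k l m : Fin 4) :
    (∏ i, d i) ^ 2 * polarForm f q q (e k) (e l) (e m) =
      (d k * d l * d m) ^ 2 * polarForm f u u (e k) (e l) (e m) := by
  have main (σ : Equiv.Perm (Fin 4)) :
      (∏ i, d i) ^ 2 * polarForm f q q (e (σ 0)) (e (σ 0)) (e (σ 1)) =
        (d (σ 0) * d (σ 0) * d (σ 1)) ^ 2 * polarForm f u u (e (σ 0)) (e (σ 0)) (e (σ 1)) ∧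
      (∏ i, d i) ^ 2 * polarForm f q q (e (σ 0)) (e (σ 1)) (e (σ 2)) =
        (d (σ 0) * d (σ 1) * d (σ 2)) ^ 2 *
          polarForm f u u (e (σ 0)) (e (σ 1)) (e (σ 2)) := by
    rw [← Equiv.sum_comp σ, Fin.sum_univ_four] at hu hq
    rw [← Equiv.prod_comp σ, Fin.prod_univ_four]
    obtain ⟨h1, h2⟩ := polarForm_sum_eq (he (σ 0)) (he (σ 1)) (he (σ 2)) (he (σ 3)) (hu ▸ hut)
    obtain ⟨h3, h4⟩ := polarForm_sum_eq ((he (σ 0)).smul _) ((he (σ 1)).smul _)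
      ((he (σ 2)).smul _) ((he (σ 3)).smul _) (hq ▸ hqt)
    rw [← hu] at h1 h2
    rw [← hq] at h3 h4
    rw [polarForm_smul, polarForm_smul, polarForm_smul_left] at h3 h4
    rw [eq_neg_iff_add_eq_zero, add_comm, ← eq_neg_iff_add_eq_zero] at h1 h2
    rw [h1] at h3
    rw [h2] at h4
    have d0 := hd (σ 0)
    have d1 := hd (σ 1)
    have d2 := hd (σ 2)
    have d3 := hd (σ 3)
    constructor
    · field_simp at h3 ⊢
      linear_combination h3
    · field_simp at h4 ⊢
      linear_combination h4
  have hperm : ∀ i j k : Fin 4, i ≠ j → i ≠ k → j ≠ k →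
      ∃ σ : Equiv.Perm (Fin 4), σ 0 = i ∧ σ 1 = j ∧ σ 2 = k := by decide
  have hperm₂ : ∀ i j : Fin 4, i ≠ j → ∃ σ : Equiv.Perm (Fin 4), σ 0 = i ∧ σ 1 = j := by decide
  by_cases hkl : k = l
  · subst hkl
    by_cases hkm : k = m
    · subst hkm
      have hz (v : Fin n → ℂ) : polarForm f v v (e k) (e k) (e k) = 0 :=
        ((he k).eval_eq_zero v v).2.2
      rw [hz, hz, mul_zero, mul_zero]
    · obtain ⟨σ, rfl, rfl⟩ := hperm₂ k m hkm
      exact (main σ).1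
  · by_cases hkm : k = m
    · subst hkm
      obtain ⟨σ, rfl, rfl⟩ := hperm₂ k l hkl
      have := (main σ).1
      simp only [polarForm_swap_right f _ _ (e (σ 0)) (e (σ 0)) (e (σ 1))]
      linear_combination this
    · by_cases hlm : l = m
      · subst hlm
        obtain ⟨σ, rfl, rfl⟩ := hperm₂ l k (Ne.symm hkl)
        have := (main σ).1
        rw [← polarForm_swap_right, ← polarForm_swap_middle, ← polarForm_swap_right f u,
          ← polarForm_swap_middle f u] at this
        rw [polarForm_swap_middle, polarForm_swap_right, polarForm_swap_middle f u,
          polarForm_swap_right f u]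
        linear_combination (main σ).1
      · obtain ⟨σ, rfl, rfl, rfl⟩ := hperm k l m hkl hkm hlm
        exact (main σ).2

theorem polarForm_sum_smul_right {n : ℕ} (f : MvPolynomial (Fin n) ℂ) {ι : Type*} [Fintype ι]
    (e : ι → Fin n → ℂ) (r s : ι → ℂ) (a b c : Fin n → ℂ) :
    polarForm f a b c (∑ i, r i • e i) (∑ i, s i • e i) =
      ∑ i, ∑ j, r i * s j * polarForm f a b c (e i) (e j) := by
  simp only [polarForm, map_sum, map_smul, LinearMap.sum_apply, LinearMap.smul_apply, smul_eval,
    Finset.mul_sum]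
  rw [Finset.sum_comm]
  exact Finset.sum_congr rfl fun i _ => Finset.sum_congr rfl fun j _ => by ring

theorem polarForm_eq_zero_of_cremona {n : ℕ} {f : MvPolynomial (Fin n) ℂ} {e : Fin 4 → Fin n → ℂ}
    (he : ∀ i, IsPolarTriple f (e i)) (hspan : ∀ w, ∃ c : Fin 4 → ℂ, w = ∑ i, c i • e i)
    {d : Fin 4 → ℂ} (hd : ∀ i, d i ≠ 0) (hu : IsPolarTriple f (∑ i, e i))
    (hq : IsPolarTriple f (∑ i, (d i)⁻¹ • e i)) (w : Fin n → ℂ) :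
    polarForm f (∑ i, e i) (∑ i, e i) (∑ i, d i • e i) (∑ i, d i • e i) w = 0 := by
  have key := polarForm_cremona he hd rfl rfl hu hq
  set u := ∑ i, e i with hu'
  set q := ∑ i, (d i)⁻¹ • e i with hq'
  have hsum (l m : Fin 4) : ∑ k, d k * polarForm f u u (e k) (e l) (e m) = 0 := by
    have h : ∑ k, (d k)⁻¹ * polarForm f q q (e k) (e l) (e m) = 0 := by
      rw [← hq (e l) (e m)]
      nth_rw 5 [hq']
      simp [polarForm, -eval_zero, smul_eval]
    have h2 : (d l * d m) ^ 2 * ∑ k, d k * polarForm f u u (e k) (e l) (e m) =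
        (∏ i, d i) ^ 2 * ∑ k, (d k)⁻¹ * polarForm f q q (e k) (e l) (e m) := by
      rw [Finset.mul_sum, Finset.mul_sum]
      refine Finset.sum_congr rfl fun k _ => ?_
      have := key k l m
      have := hd k
      field_simp
      linear_combination -key k l m
    rw [h, mul_zero] at h2
    exact (mul_eq_zero.1 h2).resolve_left (pow_ne_zero 2 (mul_ne_zero (hd l) (hd m)))
  obtain ⟨c, rfl⟩ := hspan w
  have hv (l m : Fin 4) : polarForm f u u (∑ i, d i • e i) (e l) (e m) = 0 := by
    rw [← hsum l m]
    simp [polarForm, -eval_zero, smul_eval]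
  rw [polarForm_sum_smul_right]
  simp [hv]

theorem exists_binary_quadratic_eq_zero (a b c : ℂ) :
    ∃ x y : ℂ, (x ≠ 0 ∨ y ≠ 0) ∧ a * x ^ 2 + b * (x * y) + c * y ^ 2 = 0 := by
  by_cases ha : a = 0
  · exact ⟨1, 0, by simp, by simp [ha]⟩
  · obtain ⟨s, hs⟩ := IsAlgClosed.exists_pow_nat_eq (discrim a b c) two_pos
    obtain ⟨x, hx⟩ := exists_quadratic_eq_zero ha ⟨s, by rw [← hs, sq]⟩
    exact ⟨x, 1, by simp, by linear_combination hx⟩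

theorem linearIndependent_triple {f : MvPolynomial (Fin 4) ℂ} {p q r : Fin 4 → ℂ}
    (hp : IsPolarTriple f p) (hq : IsPolarTriple f q) (hr : IsPolarTriple f r)
    (hpo : IsPolarOrdinary f p) (hpq : LinearIndependent ℂ ![p, q])
    (hrp : LinearIndependent ℂ ![r, p]) (hrq : LinearIndependent ℂ ![r, q]) :
    LinearIndependent ℂ ![r, p, q] := by
  refine linearIndependent_finCons.2 ⟨hpq, fun hmem => ?_⟩
  rw [Matrix.range_cons_cons_empty, Submodule.mem_span_pair] at hmem
  obtain ⟨α, β, rfl⟩ := hmem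
  rw [LinearIndependent.pair_iff] at hpq hrp hrq
  have hα : α ≠ 0 := by
    rintro rfl
    exact one_ne_zero (hrq 1 (-β) (by simp)).1
  have hβ : β ≠ 0 := by
    rintro rfl
    exact one_ne_zero (hrp 1 (-α) (by simp)).1
  obtain ⟨c, hc⟩ := hpo q (polarForm_eq_zero_of_collinear hp hq hα hβ hr)
  exact one_ne_zero (hpq (-c) 1 (by simp [hc])).2

theorem linearIndependent_quadruple {f : MvPolynomial (Fin 4) ℂ} {p q r s : Fin 4 → ℂ}
    (hp : IsPolarTriple f p) (hq : IsPolarTriple f q) (hr : IsPolarTriple f r)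
    (hs : IsPolarTriple f s) (hpo : IsPolarOrdinary f p)
    (hpqr : LinearIndependent ℂ ![p, q, r]) (hspq : LinearIndependent ℂ ![s, p, q])
    (hspr : LinearIndependent ℂ ![s, p, r]) (hsqr : LinearIndependent ℂ ![s, q, r]) :
    LinearIndependent ℂ ![s, p, q, r] := by
  refine linearIndependent_finCons.2 ⟨hpqr, fun hmem => ?_⟩
  have hrange : Set.range ![p, q, r] = {p, q, r} := by
    rw [Matrix.range_cons, Matrix.range_cons_cons_empty]; rfl
  rw [hrange, Submodule.mem_span_triple] at hmem
  obtain ⟨α, β, γ, rfl⟩ := hmem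
  have hpqr' := hpqr
  rw [Fintype.linearIndependent_iff] at hpqr hspq hspr hsqr
  have hα : α ≠ 0 := by
    rintro rfl
    simpa using hsqr ![1, -β, -γ] (by simp [Fin.sum_univ_three]) 0
  have hβ : β ≠ 0 := by
    rintro rfl
    simpa using hspr ![1, -α, -γ] (by simp [Fin.sum_univ_three]) 0
  have hγ : γ ≠ 0 := by
    rintro rfl
    simpa using hspq ![1, -α, -β] (by simp [Fin.sum_univ_three]) 0
  obtain ⟨h1, h2, h3⟩ := polarForm_eq_zero_of_coplanar hp hq hr hα hβ hγ hs
  obtain ⟨w, hw⟩ : ∃ w, w ∉ Submodule.span ℂ (Set.range ![p, q, r]) := by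
    by_contra! h
    have h4 := finrank_span_eq_card hpqr'
    rw [(Submodule.eq_top_iff').2 h] at h4
    simp at h4
  have hw4 : LinearIndependent ℂ ![w, p, q, r] := linearIndependent_finCons.2 ⟨hpqr', hw⟩
  have htop := hw4.span_eq_top_of_card_eq_finrank' (by simp)
  obtain ⟨x, y, hxy, hquad⟩ := exists_binary_quadratic_eq_zero (polarForm f p p q q w)
    (2 * polarForm f p p q r w) (polarForm f p p r r w)
  obtain ⟨c, hc⟩ := hpo (x • q + y • r) fun z => by
    obtain ⟨t, rfl⟩ := (Submodule.mem_span_range_iff_exists_fun ℂ).1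
      (htop ▸ Submodule.mem_top : z ∈ Submodule.span ℂ (Set.range ![w, p, q, r]))
    simp only [Fin.sum_univ_four, polarForm, map_add, map_smul, LinearMap.add_apply,
      LinearMap.smul_apply, smul_eval, Matrix.cons_val] at h1 h2 hquad ⊢
    have e1 := (hp.eval_eq_zero q q).1
    have e2 := (hp.eval_eq_zero q r).1
    have e3 := (hp.eval_eq_zero r r).1
    have e4 := (hq.eval_eq_zero p p).2.2
    have e5 := (hr.eval_eq_zero p p).2.2
    simp only [dirDeriv_comm q p, dirDeriv_comm r p, dirDeriv_comm r q] at *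
    linear_combination t 0 * hquad + t 1 * (x ^ 2 * e1 + 2 * x * y * e2 + y ^ 2 * e3) +
      t 2 * (x ^ 2 * e4 + 2 * x * y * h1 + y ^ 2 * h2) +
      t 3 * (x ^ 2 * h1 + 2 * x * y * h2 + y ^ 2 * e5)
  have h5 := hpqr ![-c, x, y] (by simp [Fin.sum_univ_three, add_assoc, hc])
  rcases hxy with hx | hy
  · exact hx (h5 1)
  · exact hy (h5 2)

theorem not_six_polarTriple {f : MvPolynomial (Fin 4) ℂ} (p : Fin 6 → Fin 4 → ℂ)
    (hp : ∀ i, IsPolarTriple f (p i)) (hpo : ∀ i, IsPolarOrdinary f (p i))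
    (hind : ∀ i j, i ≠ j → LinearIndependent ℂ ![p i, p j]) : False := by
  have h3 (i j k : Fin 6) (hij : i ≠ j) (hik : i ≠ k) (hjk : j ≠ k) :
      LinearIndependent ℂ ![p i, p j, p k] :=
    linearIndependent_triple (hp j) (hp k) (hp i) (hpo j) (hind _ _ hjk) (hind _ _ hij)
      (hind _ _ hik)
  have h4 (i j k l : Fin 6) (hij : i ≠ j) (hik : i ≠ k) (hil : i ≠ l) (hjk : j ≠ k)
      (hjl : j ≠ l) (hkl : k ≠ l) : LinearIndependent ℂ ![p i, p j, p k, p l] :=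
    linearIndependent_quadruple (hp j) (hp k) (hp l) (hp i) (hpo j) (h3 _ _ _ hjk hjl hkl)
      (h3 _ _ _ hij hik hjk) (h3 _ _ _ hij hil hjl) (h3 _ _ _ hik hil hkl)
  have hbasis := h4 0 1 2 3 (by decide) (by decide) (by decide) (by decide) (by decide) (by decide)
  have htop := hbasis.span_eq_top_of_card_eq_finrank' (by simp)
  have hspan (w : Fin 4 → ℂ) : ∃ c : Fin 4 → ℂ,
      w = c 0 • p 0 + c 1 • p 1 + c 2 • p 2 + c 3 • p 3 := by
    obtain ⟨t, rfl⟩ := (Submodule.mem_span_range_iff_exists_fun ℂ).1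
      (htop ▸ Submodule.mem_top : w ∈ Submodule.span ℂ (Set.range ![p 0, p 1, p 2, p 3]))
    exact ⟨t, by simp [Fin.sum_univ_four]⟩
  have hne (i : Fin 6) (hi : 4 ≤ i) (c : Fin 4 → ℂ)
      (hc : p i = c 0 • p 0 + c 1 • p 1 + c 2 • p 2 + c 3 • p 3) (j : Fin 4) : c j ≠ 0 := by
    have hi0 : i ≠ 0 := by rintro rfl; exact absurd hi (by decide)
    have hi1 : i ≠ 1 := by rintro rfl; exact absurd hi (by decide)
    have hi2 : i ≠ 2 := by rintro rfl; exact absurd hi (by decide)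
    have hi3 : i ≠ 3 := by rintro rfl; exact absurd hi (by decide)
    intro hj
    have g0 := h4 i 1 2 3 hi1 hi2 hi3 (by decide) (by decide) (by decide)
    have g1 := h4 i 0 2 3 hi0 hi2 hi3 (by decide) (by decide) (by decide)
    have g2 := h4 i 0 1 3 hi0 hi1 hi3 (by decide) (by decide) (by decide)
    have g3 := h4 i 0 1 2 hi0 hi1 hi2 (by decide) (by decide) (by decide)
    rw [Fintype.linearIndependent_iff] at g0 g1 g2 g3
    fin_cases j
    · have hj : c 0 = 0 := hj
      simpa using g0 ![1, -c 1, -c 2, -c 3] (by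
        simp only [Fin.sum_univ_four, Matrix.cons_val, hc, hj]; module) 0
    · have hj : c 1 = 0 := hj
      simpa using g1 ![1, -c 0, -c 2, -c 3] (by
        simp only [Fin.sum_univ_four, Matrix.cons_val, hc, hj]; module) 0
    · have hj : c 2 = 0 := hj
      simpa using g2 ![1, -c 0, -c 1, -c 3] (by
        simp only [Fin.sum_univ_four, Matrix.cons_val, hc, hj]; module) 0
    · have hj : c 3 = 0 := hj
      simpa using g3 ![1, -c 0, -c 1, -c 2] (by
        simp only [Fin.sum_univ_four, Matrix.cons_val, hc, hj]; module) 0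
  obtain ⟨α, hα⟩ := hspan (p 4)
  obtain ⟨β, hβ⟩ := hspan (p 5)
  have hα0 := hne 4 (by decide) α hα
  have hβ0 := hne 5 (by decide) β hβ
  let e : Fin 4 → Fin 4 → ℂ := ![α 0 • p 0, α 1 • p 1, α 2 • p 2, α 3 • p 3]
  let d : Fin 4 → ℂ := fun i => α i / β i
  have hd (i : Fin 4) : d i ≠ 0 := div_ne_zero (hα0 i) (hβ0 i)
  have hu : ∑ i, e i = p 4 := by simp [e, Fin.sum_univ_four, hα]
  have hq : ∑ i, (d i)⁻¹ • e i = p 5 := by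
    simp [e, d, Fin.sum_univ_four, hβ, smul_smul, hα0]
  have he (i : Fin 4) : IsPolarTriple f (e i) := by
    fin_cases i <;> exact (hp _).smul _
  have hespan (w : Fin 4 → ℂ) : ∃ c : Fin 4 → ℂ, w = ∑ i, c i • e i := by
    obtain ⟨c, hc⟩ := hspan w
    exact ⟨fun i => c i / α i, by simp [e, Fin.sum_univ_four, hc, smul_smul, hα0]⟩
  obtain ⟨c, hc⟩ := hpo 4 (∑ i, d i • e i) fun w => by
    have := polarForm_eq_zero_of_cremona he hespan hd (hu ▸ hp 4) (hq ▸ hp 5) w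
    rwa [hu] at this
  have hdc : ∀ i, d i = c := by
    rw [hα, Fin.sum_univ_four] at hc
    rw [Fintype.linearIndependent_iff] at hbasis
    have h := hbasis (fun i => (d i - c) * α i) (by
      simp only [Fin.sum_univ_four, Matrix.cons_val, sub_mul, sub_smul, mul_smul]
      simp only [e, Matrix.cons_val, smul_add] at hc
      linear_combination (exp := 1) hc)
    intro i
    exact sub_eq_zero.1 ((mul_eq_zero.1 (h i)).resolve_right (hα0 i))
  have h45 : p 4 = c • p 5 := by
    have hc0 : c ≠ 0 := hdc 0 ▸ hd 0
    rw [← hu, ← hq, Finset.smul_sum]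
    simp [hdc, smul_smul, hc0]
  exact one_ne_zero ((LinearIndependent.pair_iff.1 (hind 4 5 (by decide))) 1 (-c)
    (by simp [h45])).1

theorem isPolarOrdinary_of_ordinaryTriplePointAt {f : MvPolynomial (Fin 4) ℂ}
    (hf : f.IsHomogeneous 5) {p : Fin 4 → ℂ} (hp : OrdinaryTriplePointAt 5 f p) :
    IsPolarOrdinary f p :=
  exists_eq_smul_of_ordinaryTriplePointAt hf hp

theorem le_five_of_onlyTriplePoints {ν : ℕ} {f : MvPolynomial (Fin 4) ℂ} (hf : f.IsHomogeneous 5)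
    (h : OnlyTriplePoints 5 ν f) : ν ≤ 5 := by
  obtain ⟨hfin, rfl, hord⟩ := h
  by_contra! hcard
  have := hfin.fintype
  rw [← Nat.card_coe_set_eq, Nat.card_eq_fintype_card] at hcard
  obtain ⟨g⟩ := Function.Embedding.nonempty_of_card_le
    (α := Fin 6) (β := SingSet f) (by simpa using Nat.succ_le_of_lt hcard)
  refine not_six_polarTriple (f := f) (fun i => (g i).1.rep)
    (fun i => polarForm_eq_zero_of_multAtLeast hf (hord _ (g i).2).1)
    (fun i => isPolarOrdinary_of_ordinaryTriplePointAt hf (hord _ (g i).2)) fun i j hij => ?_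
  have hne : (g i).1 ≠ (g j).1 := fun h => hij (g.injective (Subtype.ext h))
  rw [← Projectivization.independent_pair_iff_ne, Projectivization.independent_iff] at hne
  have hcomp : Projectivization.rep ∘ ![(g i).1, (g j).1] = ![(g i).1.rep, (g j).1.rep] := by
    ext k : 1
    fin_cases k <;> rfl
  rwa [hcomp] at hne

/-- A quintic surface with five ordinary triple points, at the coordinate points and at
`(1, 1, 1, 1)`; it is the Cremona transform of a cone over a smooth plane cubic. -/
def fiveTriplePointQuintic : MvPolynomial (Fin 4) ℂ :=
  C 3 * (X 2 ^ 2 * X 3 ^ 2 * (X 1 - X 0)) + X 0 ^ 2 * X 3 ^ 2 * (X 2 - X 1) +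
    C 3 * (X 1 ^ 2 * X 3 ^ 2 * (X 2 - X 0)) - C 6 * (X 1 ^ 2 * X 2 ^ 2 * (X 3 - X 0)) +
    C 2 * (X 0 ^ 2 * X 2 ^ 2 * (X 3 - X 1)) + C 4 * (X 0 ^ 2 * X 1 ^ 2 * (X 3 - X 2))

theorem fiveTriplePointQuintic_isHomogeneous : fiveTriplePointQuintic.IsHomogeneous 5 := by
  have h (i j k l : Fin 4) :
      (X i ^ 2 * X j ^ 2 * (X k - X l) : MvPolynomial (Fin 4) ℂ).IsHomogeneous 5 :=
    ((isHomogeneous_X_pow i 2).mul (isHomogeneous_X_pow j 2)).mul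
      ((isHomogeneous_X ℂ k).sub (isHomogeneous_X ℂ l))
  exact (((((h _ _ _ _).C_mul _).add (h _ _ _ _)).add ((h _ _ _ _).C_mul _)).sub
    ((h _ _ _ _).C_mul _)).add ((h _ _ _ _).C_mul _) |>.add ((h _ _ _ _).C_mul _)

theorem eval_fiveTriplePointQuintic (x : Fin 4 → ℂ) :
    eval x fiveTriplePointQuintic =
      3 * (x 2 ^ 2 * x 3 ^ 2 * (x 1 - x 0)) + x 0 ^ 2 * x 3 ^ 2 * (x 2 - x 1) +
      3 * (x 1 ^ 2 * x 3 ^ 2 * (x 2 - x 0)) - 6 * (x 1 ^ 2 * x 2 ^ 2 * (x 3 - x 0)) +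
      2 * (x 0 ^ 2 * x 2 ^ 2 * (x 3 - x 1)) + 4 * (x 0 ^ 2 * x 1 ^ 2 * (x 3 - x 2)) := by
  simp [fiveTriplePointQuintic]

theorem eval_pderiv_fiveTriplePointQuintic (x : Fin 4 → ℂ) :
    eval x (pderiv 0 fiveTriplePointQuintic) =
      -3 * (x 2 ^ 2 * x 3 ^ 2) + 2 * (x 0 * x 3 ^ 2 * (x 2 - x 1)) -
      3 * (x 1 ^ 2 * x 3 ^ 2) + 6 * (x 1 ^ 2 * x 2 ^ 2) +
      4 * (x 0 * x 2 ^ 2 * (x 3 - x 1)) + 8 * (x 0 * x 1 ^ 2 * (x 3 - x 2)) ∧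
    eval x (pderiv 1 fiveTriplePointQuintic) =
      3 * (x 2 ^ 2 * x 3 ^ 2) - x 0 ^ 2 * x 3 ^ 2 +
      6 * (x 1 * x 3 ^ 2 * (x 2 - x 0)) - 12 * (x 1 * x 2 ^ 2 * (x 3 - x 0)) -
      2 * (x 0 ^ 2 * x 2 ^ 2) + 8 * (x 0 ^ 2 * x 1 * (x 3 - x 2)) ∧
    eval x (pderiv 2 fiveTriplePointQuintic) =
      6 * (x 2 * x 3 ^ 2 * (x 1 - x 0)) + x 0 ^ 2 * x 3 ^ 2 +
      3 * (x 1 ^ 2 * x 3 ^ 2) - 12 * (x 1 ^ 2 * x 2 * (x 3 - x 0)) +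
      4 * (x 0 ^ 2 * x 2 * (x 3 - x 1)) - 4 * (x 0 ^ 2 * x 1 ^ 2) ∧
    eval x (pderiv 3 fiveTriplePointQuintic) =
      6 * (x 2 ^ 2 * x 3 * (x 1 - x 0)) + 2 * (x 0 ^ 2 * x 3 * (x 2 - x 1)) +
      6 * (x 1 ^ 2 * x 3 * (x 2 - x 0)) - 6 * (x 1 ^ 2 * x 2 ^ 2) +
      2 * (x 0 ^ 2 * x 2 ^ 2) + 4 * (x 0 ^ 2 * x 1 ^ 2) := by
  refine ⟨?_, ?_, ?_, ?_⟩ <;>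
  · simp [fiveTriplePointQuintic, pderiv_X, Derivation.leibniz_pow]
    ring

/-- The cubic forms in three variables without pure cubes and without a mixed term. -/
def hexaCubic (a : Fin 6 → ℂ) : MvPolynomial (Fin 3) ℂ :=
  C (a 0) * (X 1 * X 2 ^ 2) + C (a 1) * (X 0 * X 2 ^ 2) + C (a 2) * (X 1 ^ 2 * X 2) +
    C (a 3) * (X 0 * X 1 ^ 2) + C (a 4) * (X 0 ^ 2 * X 2) + C (a 5) * (X 0 ^ 2 * X 1)

theorem isHomogeneous_hexaCubic (a : Fin 6 → ℂ) : (hexaCubic a).IsHomogeneous 3 := by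
  have h (i j : Fin 3) : (X i ^ 2 * X j : MvPolynomial (Fin 3) ℂ).IsHomogeneous 3 :=
    (isHomogeneous_X_pow i 2).mul (isHomogeneous_X ℂ j)
  have h' (i j : Fin 3) : (X i * X j ^ 2 : MvPolynomial (Fin 3) ℂ).IsHomogeneous 3 :=
    (isHomogeneous_X ℂ i).mul (isHomogeneous_X_pow j 2)
  exact (((((h' _ _).C_mul _).add ((h' _ _).C_mul _)).add ((h _ _).C_mul _)).add
    ((h' _ _).C_mul _)).add ((h _ _).C_mul _) |>.add ((h _ _).C_mul _)

theorem nowhereSingular_hexaCubic {a : Fin 6 → ℂ}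
    (h : ∀ x y z : ℂ, a 1 * z ^ 2 + a 3 * y ^ 2 + 2 * a 4 * x * z + 2 * a 5 * x * y = 0 →
      a 0 * z ^ 2 + 2 * a 2 * y * z + 2 * a 3 * x * y + a 5 * x ^ 2 = 0 →
      2 * a 0 * y * z + 2 * a 1 * x * z + a 2 * y ^ 2 + a 4 * x ^ 2 = 0 →
      x ^ 4 = 0 ∧ y ^ 4 = 0 ∧ z ^ 4 = 0) :
    NowhereSingular (hexaCubic a) := by
  intro p hp
  by_contra! hs
  have h0 := hs 0
  have h1 := hs 1
  have h2 := hs 2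
  simp [hexaCubic, pderiv_X, Derivation.leibniz_pow] at h0 h1 h2
  obtain ⟨hx, hy, hz⟩ := h (p 0) (p 1) (p 2) (by linear_combination h0)
    (by linear_combination h1) (by linear_combination h2)
  refine hp (funext fun i => ?_)
  fin_cases i
  · exact eq_zero_of_pow_eq_zero hx
  · exact eq_zero_of_pow_eq_zero hy
  · exact eq_zero_of_pow_eq_zero hz

theorem OrdinaryTriplePointAt.of_hexaCubic {f : MvPolynomial (Fin 4) ℂ} {p : Fin 4 → ℂ}
    (hp : MultAtLeast f p 3) {i j : Fin 4} (hij : eval p (pderivList [i, j, j] f) ≠ 0)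
    {B : Matrix (Fin 4) (Fin 4) ℂ} (hB : B.det ≠ 0) (hBp : B.mulVec ![0, 0, 0, 1] = p)
    {t : ℂ} (ht : t ≠ 0) {a : Fin 6 → ℂ} {q₄ q₅ : MvPolynomial (Fin 3) ℂ}
    (h₄ : q₄.IsHomogeneous 4) (h₅ : q₅.IsHomogeneous 5)
    (hf : substMatrix B f = X 3 ^ 2 * rename Fin.castSucc (C (t ^ 2) * hexaCubic a) +
      X 3 * rename Fin.castSucc (C t * q₄) + rename Fin.castSucc q₅)
    (ha : NowhereSingular (hexaCubic a)) : OrdinaryTriplePointAt 5 f p := by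
  refine ⟨hp, ⟨_, rfl, hij⟩, B, hB.isUnit, hBp, fun k =>
    if k = 3 then C (t ^ 2) * hexaCubic a else if k = 4 then C t * q₄ else
      if k = 5 then q₅ else 0, fun k => ?_, ?_, fun v hv => ?_⟩
  · dsimp only
    split_ifs with h3 h4 h5
    · subst h3
      exact (isHomogeneous_hexaCubic a).C_mul _
    · subst h4
      exact h₄.C_mul _
    · subst h5
      exact h₅
    · exact isHomogeneous_zero _ _ _
  · rw [hf]
    simp [Finset.sum_range_succ]
  · obtain ⟨k, hk⟩ := ha v hv
    exact ⟨k, by simpa [ht] using hk⟩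

theorem multAtLeast_three {f : MvPolynomial (Fin 4) ℂ} {p : Fin 4 → ℂ} (h₀ : eval p f = 0)
    (h₁ : ∀ i, eval p (pderiv i f) = 0) (h₂ : ∀ i j, eval p (pderiv i (pderiv j f)) = 0) :
    MultAtLeast f p 3
  | [], _ => h₀
  | [i], _ => h₁ i
  | [i, j], _ => h₂ j i
  | _ :: _ :: _ :: _, h => by simp only [List.length_cons] at h; omega

/-- A linear combination of the products of the squares of two of three variables. -/
def pairQuartic (a : Fin 3 → ℂ) : MvPolynomial (Fin 3) ℂ :=
  C (a 0) * (X 1 ^ 2 * X 2 ^ 2) + C (a 1) * (X 0 ^ 2 * X 2 ^ 2) + C (a 2) * (X 0 ^ 2 * X 1 ^ 2)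

theorem isHomogeneous_pairQuartic (a : Fin 3 → ℂ) : (pairQuartic a).IsHomogeneous 4 := by
  have h (i j : Fin 3) : (X i ^ 2 * X j ^ 2 : MvPolynomial (Fin 3) ℂ).IsHomogeneous 4 :=
    (isHomogeneous_X_pow i 2).mul (isHomogeneous_X_pow j 2)
  exact (((h _ _).C_mul _).add ((h _ _).C_mul _)).add ((h _ _).C_mul _)

/-- The product of the three variables and a linear form. -/
def lineQuartic (a : Fin 3 → ℂ) : MvPolynomial (Fin 3) ℂ :=
  X 0 * X 1 * X 2 * (C (a 0) * X 0 + C (a 1) * X 1 + C (a 2) * X 2)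

theorem isHomogeneous_lineQuartic (a : Fin 3 → ℂ) : (lineQuartic a).IsHomogeneous 4 := by
  have h (i : Fin 3) : (X i : MvPolynomial (Fin 3) ℂ).IsHomogeneous 1 := isHomogeneous_X ℂ i
  exact (((h 0).mul (h 1)).mul (h 2)).mul
    ((((h _).C_mul _).add ((h _).C_mul _)).add ((h _).C_mul _))

/-- The product of the three variables and a conic through the coordinate points. -/
def conicQuintic (a : Fin 3 → ℂ) : MvPolynomial (Fin 3) ℂ :=
  X 0 * X 1 * X 2 * (C (a 0) * (X 1 * X 2) + C (a 1) * (X 0 * X 2) + C (a 2) * (X 0 * X 1))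

theorem isHomogeneous_conicQuintic (a : Fin 3 → ℂ) : (conicQuintic a).IsHomogeneous 5 := by
  have h (i : Fin 3) : (X i : MvPolynomial (Fin 3) ℂ).IsHomogeneous 1 := isHomogeneous_X ℂ i
  exact (((h 0).mul (h 1)).mul (h 2)).mul
    (((((h _).mul (h _)).C_mul _).add (((h _).mul (h _)).C_mul _)).add (((h _).mul (h _)).C_mul _))

theorem ordinaryTriplePointAt_coordZero {t : ℂ} (ht : t ≠ 0) :
    OrdinaryTriplePointAt 5 fiveTriplePointQuintic ![t, 0, 0, 0] := by
  refine OrdinaryTriplePointAt.of_hexaCubic (i := 2) (j := 3)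
    (B := !![0, 0, 0, t; 1, 0, 0, 0; 0, 1, 0, 0; 0, 0, 1, 0]) (a := ![1, -1, 2, -2, 4, -4])
    (multAtLeast_three ?_ (fun i => ?_) (fun i j => ?_)) ?_ ?_ ?_ ht
    (isHomogeneous_pairQuartic ![-3, -3, 6]) (isHomogeneous_conicQuintic ![3, 3, -6]) ?_
    (nowhereSingular_hexaCubic fun x y z hx hy hz => ?_)
  · simp [eval_fiveTriplePointQuintic]
  · fin_cases i <;> simp [eval_pderiv_fiveTriplePointQuintic]
  · fin_cases i <;> fin_cases j <;>
      simp [fiveTriplePointQuintic, pderiv_X, Derivation.leibniz_pow]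
  · simp [pderivList, fiveTriplePointQuintic, pderiv_X, Derivation.leibniz_pow, ht]
  · simp [Matrix.det_succ_row_zero, Fin.sum_univ_succ, Fin.succAbove, ht]
  · ext i
    fin_cases i <;> simp [Matrix.mulVec, dotProduct, Fin.sum_univ_succ]
  · simp [substMatrix, fiveTriplePointQuintic, hexaCubic, pairQuartic, conicQuintic,
      Fin.sum_univ_four]
    ring
  · simp at hx hy hz
    refine ⟨?_, ?_, ?_⟩ <;> grind

theorem ordinaryTriplePointAt_coordOne {t : ℂ} (ht : t ≠ 0) :
    OrdinaryTriplePointAt 5 fiveTriplePointQuintic ![0, t, 0, 0] := by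
  refine OrdinaryTriplePointAt.of_hexaCubic (i := 2) (j := 3)
    (B := !![1, 0, 0, 0; 0, 0, 0, t; 0, 1, 0, 0; 0, 0, 1, 0]) (a := ![3, -3, -6, 6, 4, -4])
    (multAtLeast_three ?_ (fun i => ?_) (fun i j => ?_)) ?_ ?_ ?_ ht
    (isHomogeneous_pairQuartic ![3, -1, -2]) (isHomogeneous_conicQuintic ![-3, 1, 2]) ?_
    (nowhereSingular_hexaCubic fun x y z hx hy hz => ?_)
  · simp [eval_fiveTriplePointQuintic]
  · fin_cases i <;> simp [eval_pderiv_fiveTriplePointQuintic]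
  · fin_cases i <;> fin_cases j <;>
      simp [fiveTriplePointQuintic, pderiv_X, Derivation.leibniz_pow]
  · simp [pderivList, fiveTriplePointQuintic, pderiv_X, Derivation.leibniz_pow, ht]
  · simp [Matrix.det_succ_row_zero, Fin.sum_univ_succ, Fin.succAbove, ht]
  · ext i
    fin_cases i <;> simp [Matrix.mulVec, dotProduct, Fin.sum_univ_succ]
  · simp [substMatrix, fiveTriplePointQuintic, hexaCubic, pairQuartic, conicQuintic,
      Fin.sum_univ_four]
    ring
  · simp at hx hy hz
    refine ⟨?_, ?_, ?_⟩ <;> grind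

theorem ordinaryTriplePointAt_coordTwo {t : ℂ} (ht : t ≠ 0) :
    OrdinaryTriplePointAt 5 fiveTriplePointQuintic ![0, 0, t, 0] := by
  refine OrdinaryTriplePointAt.of_hexaCubic (i := 1) (j := 3)
    (B := !![1, 0, 0, 0; 0, 1, 0, 0; 0, 0, 0, t; 0, 0, 1, 0]) (a := ![3, -3, -6, 6, 2, -2])
    (multAtLeast_three ?_ (fun i => ?_) (fun i j => ?_)) ?_ ?_ ?_ ht
    (isHomogeneous_pairQuartic ![3, 1, -4]) (isHomogeneous_conicQuintic ![-3, -1, 4]) ?_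
    (nowhereSingular_hexaCubic fun x y z hx hy hz => ?_)
  · simp [eval_fiveTriplePointQuintic]
  · fin_cases i <;> simp [eval_pderiv_fiveTriplePointQuintic]
  · fin_cases i <;> fin_cases j <;>
      simp [fiveTriplePointQuintic, pderiv_X, Derivation.leibniz_pow]
  · simp [pderivList, fiveTriplePointQuintic, pderiv_X, Derivation.leibniz_pow, ht]
  · simp [Matrix.det_succ_row_zero, Fin.sum_univ_succ, Fin.succAbove, ht]
  · ext i
    fin_cases i <;> simp [Matrix.mulVec, dotProduct, Fin.sum_univ_succ]
  · simp [substMatrix, fiveTriplePointQuintic, hexaCubic, pairQuartic, conicQuintic,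
      Fin.sum_univ_four]
    ring
  · simp at hx hy hz
    refine ⟨?_, ?_, ?_⟩ <;> grind

theorem ordinaryTriplePointAt_coordThree {t : ℂ} (ht : t ≠ 0) :
    OrdinaryTriplePointAt 5 fiveTriplePointQuintic ![0, 0, 0, t] := by
  refine OrdinaryTriplePointAt.of_hexaCubic (i := 1) (j := 2)
    (B := !![1, 0, 0, 0; 0, 1, 0, 0; 0, 0, 1, 0; 0, 0, 0, t]) (a := ![3, -3, 3, -3, 1, -1])
    (multAtLeast_three ?_ (fun i => ?_) (fun i j => ?_)) ?_ ?_ ?_ ht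
    (isHomogeneous_pairQuartic ![-6, 2, 4]) (isHomogeneous_conicQuintic ![6, -2, -4]) ?_
    (nowhereSingular_hexaCubic fun x y z hx hy hz => ?_)
  · simp [eval_fiveTriplePointQuintic]
  · fin_cases i <;> simp [eval_pderiv_fiveTriplePointQuintic]
  · fin_cases i <;> fin_cases j <;>
      simp [fiveTriplePointQuintic, pderiv_X, Derivation.leibniz_pow]
  · simp [pderivList, fiveTriplePointQuintic, pderiv_X, Derivation.leibniz_pow, ht]
  · simp [Matrix.det_succ_row_zero, Fin.sum_univ_succ, Fin.succAbove, ht]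
  · ext i
    fin_cases i <;> simp [Matrix.mulVec, dotProduct, Fin.sum_univ_succ]
  · simp [substMatrix, fiveTriplePointQuintic, hexaCubic, pairQuartic, conicQuintic,
      Fin.sum_univ_four]
    ring
  · simp at hx hy hz
    refine ⟨?_, ?_, ?_⟩ <;> grind

theorem ordinaryTriplePointAt_allEqual {t : ℂ} (ht : t ≠ 0) :
    OrdinaryTriplePointAt 5 fiveTriplePointQuintic ![t, t, t, t] := by
  refine OrdinaryTriplePointAt.of_hexaCubic (i := 1) (j := 2)
    (B := !![1, 0, 0, t; 0, 1, 0, t; 0, 0, 1, t; 0, 0, 0, t]) (a := ![1, 3, -1, 3, -3, -3])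
    (multAtLeast_three ?_ (fun i => ?_) (fun i j => ?_)) ?_ ?_ ?_ ht
    (isHomogeneous_lineQuartic ![-12, 4, 8]) (isHomogeneous_conicQuintic ![6, -2, -4]) ?_
    (nowhereSingular_hexaCubic fun x y z hx hy hz => ?_)
  · simp [eval_fiveTriplePointQuintic]
  · fin_cases i <;> simp [eval_pderiv_fiveTriplePointQuintic]
    all_goals ring
  · fin_cases i <;> fin_cases j <;>
      simp [fiveTriplePointQuintic, pderiv_X, Derivation.leibniz_pow]
    all_goals ring
  · have h2 (i : Fin 4) : pderiv i (2 : MvPolynomial (Fin 4) ℂ) = 0 := by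
      rw [← map_ofNat C, pderiv_C]
    simp [pderivList, fiveTriplePointQuintic, pderiv_X, Derivation.leibniz_pow, h2]
    ring_nf
    simp [ht]
  · simp [Matrix.det_succ_row_zero, Fin.sum_univ_succ, Fin.succAbove, ht]
  · ext i
    fin_cases i <;> simp [Matrix.mulVec, dotProduct, Fin.sum_univ_succ]
  · simp [substMatrix, fiveTriplePointQuintic, hexaCubic, lineQuartic, conicQuintic,
      Fin.sum_univ_four]
    simp only [map_ofNat]
    ring
  · simp at hx hy hz
    refine ⟨?_, ?_, ?_⟩ <;> grind

theorem eq_of_singularAt_fiveTriplePointQuintic {x : Fin 4 → ℂ}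
    (h : SingularAt fiveTriplePointQuintic x) :
    ∃ t : ℂ, x = ![t, 0, 0, 0] ∨ x = ![0, t, 0, 0] ∨ x = ![0, 0, t, 0] ∨ x = ![0, 0, 0, t] ∨
      x = ![t, t, t, t] := by
  have hf : eval x fiveTriplePointQuintic = 0 := h [] (by simp)
  have hd (i : Fin 4) : eval x (pderiv i fiveTriplePointQuintic) = 0 := h [i] (by simp)
  obtain ⟨e0, e1, e2, e3⟩ := eval_pderiv_fiveTriplePointQuintic x
  rw [eval_fiveTriplePointQuintic] at hf
  rw [hd] at e0 e1 e2 e3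
  have hx : x = ![x 0, x 1, x 2, x 3] := by ext i; fin_cases i <;> rfl
  rw [hx]
  generalize x 0 = a at *
  generalize x 1 = b at *
  generalize x 2 = c at *
  generalize x 3 = d at *
  clear hx hd h
  by_cases ha : a = 0
  · subst ha
    have h1 : b * c * d = 0 := by grind
    have : b = 0 ∧ c = 0 ∨ b = 0 ∧ d = 0 ∨ c = 0 ∧ d = 0 := by grind
    rcases this with ⟨rfl, rfl⟩ | ⟨rfl, rfl⟩ | ⟨rfl, rfl⟩
    exacts [⟨d, by simp⟩, ⟨c, by simp⟩, ⟨b, by simp⟩]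
  by_cases hb : b = 0
  · subst hb
    have h1 : a * c * d = 0 := by grind
    have : c = 0 ∧ d = 0 := by grind
    exact ⟨a, by simp [this]⟩
  by_cases hc : c = 0
  · subst hc
    have h1 : d = 0 := by grind
    grind
  by_cases hd : d = 0
  · subst hd
    grind
  have hP : a * b * c * d ≠ 0 := by simp [ha, hb, hc, hd]
  obtain ⟨z0, hz0⟩ : ∃ z, z = b * c * d - a * b * c := ⟨_, rfl⟩
  obtain ⟨z1, hz1⟩ : ∃ z, z = a * c * d - a * b * c := ⟨_, rfl⟩
  obtain ⟨z2, hz2⟩ : ∃ z, z = a * b * d - a * b * c := ⟨_, rfl⟩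
  have g0 : 6 * z0 * z1 - 3 * z1 ^ 2 + 6 * z0 * z2 - 3 * z2 ^ 2 = 0 := by
    refine (mul_eq_zero.1 (?_ : b * c * d * _ = 0)).resolve_left (by simp [hb, hc, hd])
    rw [hz0, hz1, hz2]
    linear_combination a * b * c * d * (2 * hf + a * e0)
  have g1 : 3 * z0 ^ 2 - 6 * z0 * z1 + 2 * z1 * z2 - z2 ^ 2 = 0 := by
    refine (mul_eq_zero.1 (?_ : a * c * d * _ = 0)).resolve_left (by simp [ha, hc, hd])
    rw [hz0, hz1, hz2]
    linear_combination a * b * c * d * (2 * hf + b * e1)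
  have g2 : z1 ^ 2 - 2 * z1 * z2 + 3 * z0 ^ 2 - 6 * z0 * z2 = 0 := by
    refine (mul_eq_zero.1 (?_ : a * b * d * _ = 0)).resolve_left (by simp [ha, hb, hd])
    rw [hz0, hz1, hz2]
    linear_combination a * b * c * d * (2 * hf + c * e2)
  have k0 : z0 ^ 4 = 0 := by clear hz0 hz1 hz2 hf e0 e1 e2 e3; grind
  have k1 : z1 ^ 4 = 0 := by clear hz0 hz1 hz2 hf e0 e1 e2 e3; grind
  have k2 : z2 ^ 4 = 0 := by clear hz0 hz1 hz2 hf e0 e1 e2 e3; grind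
  replace k0 := eq_zero_of_pow_eq_zero k0
  replace k1 := eq_zero_of_pow_eq_zero k1
  replace k2 := eq_zero_of_pow_eq_zero k2
  have j0 : d = a := mul_left_cancel₀ (mul_ne_zero hb hc) (by linear_combination k0 - hz0)
  have j1 : d = b := mul_left_cancel₀ (mul_ne_zero ha hc) (by linear_combination k1 - hz1)
  have j2 : d = c := mul_left_cancel₀ (mul_ne_zero ha hb) (by linear_combination k2 - hz2)
  exact ⟨d, by simp [← j0, ← j1, ← j2]⟩

theorem ordinaryTriplePointAt_of_singularAt {x : Fin 4 → ℂ} (hx : x ≠ 0)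
    (h : SingularAt fiveTriplePointQuintic x) :
    OrdinaryTriplePointAt 5 fiveTriplePointQuintic x := by
  obtain ⟨t, h⟩ := eq_of_singularAt_fiveTriplePointQuintic h
  have ht : t ≠ 0 := by
    rintro rfl
    refine hx ?_
    rcases h with rfl | rfl | rfl | rfl | rfl <;> simp
  rcases h with rfl | rfl | rfl | rfl | rfl
  exacts [ordinaryTriplePointAt_coordZero ht, ordinaryTriplePointAt_coordOne ht,
    ordinaryTriplePointAt_coordTwo ht, ordinaryTriplePointAt_coordThree ht,
    ordinaryTriplePointAt_allEqual ht]

/-- Representatives of the five triple points. -/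
def triplePointRep : Fin 5 → Fin 4 → ℂ :=
  ![![1, 0, 0, 0], ![0, 1, 0, 0], ![0, 0, 1, 0], ![0, 0, 0, 1], ![1, 1, 1, 1]]

theorem triplePointRep_ne_zero (i : Fin 5) : triplePointRep i ≠ 0 := by
  fin_cases i <;> simp [triplePointRep]

theorem injective_mk_triplePointRep : Function.Injective fun i =>
    Projectivization.mk ℂ (triplePointRep i) (triplePointRep_ne_zero i) := by
  intro i j hij
  obtain ⟨a, ha⟩ := (Projectivization.mk_eq_mk_iff' _ _ _ _ _).1 hij
  have h0 := congrFun ha 0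
  have h1 := congrFun ha 1
  have h2 := congrFun ha 2
  have h3 := congrFun ha 3
  clear hij ha
  fin_cases i <;> fin_cases j <;> simp [triplePointRep] at h0 h1 h2 h3 ⊢ <;> simp_all

theorem singularAt_smul_triplePointRep (i : Fin 5) {t : ℂ} (ht : t ≠ 0) :
    SingularAt fiveTriplePointQuintic (t • triplePointRep i) := by
  have h {x : Fin 4 → ℂ} (hx : OrdinaryTriplePointAt 5 fiveTriplePointQuintic x) :
      SingularAt fiveTriplePointQuintic x := fun l hl => hx.1 l (by omega)
  fin_cases i
  · simpa [triplePointRep] using h (ordinaryTriplePointAt_coordZero ht)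
  · simpa [triplePointRep] using h (ordinaryTriplePointAt_coordOne ht)
  · simpa [triplePointRep] using h (ordinaryTriplePointAt_coordTwo ht)
  · simpa [triplePointRep] using h (ordinaryTriplePointAt_coordThree ht)
  · simpa [triplePointRep] using h (ordinaryTriplePointAt_allEqual ht)

theorem singSet_fiveTriplePointQuintic : SingSet fiveTriplePointQuintic = Set.range fun i =>
    Projectivization.mk ℂ (triplePointRep i) (triplePointRep_ne_zero i) := by
  ext P
  constructor
  · intro hP
    obtain ⟨t, h⟩ := eq_of_singularAt_fiveTriplePointQuintic hP
    obtain ⟨i, hi⟩ : ∃ i, t • triplePointRep i = P.rep := by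
      rcases h with h | h | h | h | h
      · exact ⟨0, by simp [triplePointRep, h]⟩
      · exact ⟨1, by simp [triplePointRep, h]⟩
      · exact ⟨2, by simp [triplePointRep, h]⟩
      · exact ⟨3, by simp [triplePointRep, h]⟩
      · exact ⟨4, by simp [triplePointRep, h]⟩
    refine ⟨i, ?_⟩
    have ht : t ≠ 0 := by
      rintro rfl
      exact P.rep_nonzero (by rw [← hi, zero_smul])
    dsimp only
    rw [← P.mk_rep, Projectivization.mk_eq_mk_iff']
    exact ⟨t⁻¹, by rw [← hi, inv_smul_smul₀ ht]⟩
  · rintro ⟨i, rfl⟩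
    obtain ⟨a, ha⟩ := Projectivization.exists_smul_eq_mk_rep ℂ _ (triplePointRep_ne_zero i)
    change SingularAt _ _
    rw [← ha]
    exact singularAt_smul_triplePointRep i a.ne_zero

theorem onlyTriplePoints_fiveTriplePointQuintic : OnlyTriplePoints 5 5 fiveTriplePointQuintic := by
  refine ⟨?_, ?_, fun P hP => ordinaryTriplePointAt_of_singularAt P.rep_nonzero hP⟩
  · rw [singSet_fiveTriplePointQuintic]
    exact Set.finite_range _
  · rw [singSet_fiveTriplePointQuintic, Set.ncard_range_of_injective injective_mk_triplePointRep,
      Nat.card_fin]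

theorem fiveTriplePointQuintic_ne_zero : fiveTriplePointQuintic ≠ 0 := by
  intro h
  have := eval_fiveTriplePointQuintic ![0, 1, 1, 2]
  simp [h] at this
  norm_num at this

/-- Every quintic surface whose only singularities are `ν` ordinary triple
points satisfies `ν ≤ 5`, and there is a quintic with exactly `5` ordinary triple points
as its only singularities.  Hence `μ₃(5) = 5`. -/
theorem mu3_of_quintics :
    (∀ (ν : ℕ) (f : MvPolynomial (Fin 4) ℂ), f ≠ 0 → f.IsHomogeneous 5 →
      OnlyTriplePoints 5 ν f → ν ≤ 5) ∧
    (∃ f : MvPolynomial (Fin 4) ℂ, f ≠ 0 ∧ f.IsHomogeneous 5 ∧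
      OnlyTriplePoints 5 5 f) := by
  exact ⟨fun ν f _ hf h => le_five_of_onlyTriplePoints hf h, fiveTriplePointQuintic,
    fiveTriplePointQuintic_ne_zero, fiveTriplePointQuintic_isHomogeneous,
    onlyTriplePoints_fiveTriplePointQuintic⟩
end
end

section
/- Let d ≥ 5 and let X = {f = 0} ⊂ ℙ³(ℂ) be a surface of degree d whose only singularities are ν ordinary triple points. If there exists a nonzero homogeneous polynomial of degree d − 4 vanishing at every triple point of X, then ν ≤ d(d−1)(d−4)/6 (the polar bound). -/
open MvPolynomial

noncomputable section

section HilbertFunction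

attribute [local instance] MvPolynomial.gradedAlgebra

variable {σ : Type*} {k : Type*} [Field k]

/-- The degree-`n` piece of an ideal of a polynomial ring. -/
def gradedPiece (I : Ideal (MvPolynomial σ k)) (n : ℕ) : Submodule k (MvPolynomial σ k) :=
  I.restrictScalars k ⊓ homogeneousSubmodule σ k n

lemma mem_gradedPiece {I : Ideal (MvPolynomial σ k)} {n : ℕ} {x : MvPolynomial σ k} :
    x ∈ gradedPiece I n ↔ x ∈ I ∧ x.IsHomogeneous n := Iff.rfl

lemma homogeneousComponent_mul_of_isHomogeneous {w : MvPolynomial σ k} {e : ℕ}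
    (hw : w.IsHomogeneous e) (y : MvPolynomial σ k) (n : ℕ) :
    homogeneousComponent (n + e) (w * y) = w * homogeneousComponent n y := by
  have h := DirectSum.coe_decompose_mul_of_left_mem_of_le (𝒜 := homogeneousSubmodule σ k)
    (n := n + e) (b := y) ((mem_homogeneousSubmodule e w).2 hw) (Nat.le_add_left e n)
  rw [Nat.add_sub_cancel] at h
  have key : ∀ (x : MvPolynomial σ k) (i : ℕ),
      (DirectSum.decompose (homogeneousSubmodule σ k) x i : MvPolynomial σ k) =
        homogeneousComponent i x := fun x i => decomposition.decompose'_apply x i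
  rwa [key, key] at h

instance [Finite σ] (n : ℕ) : FiniteDimensional k (homogeneousSubmodule σ k n) :=
  Module.Finite.iff_fg.2 (homogeneousSubmodule_fg σ k n)

instance [Finite σ] (I : Ideal (MvPolynomial σ k)) (n : ℕ) :
    FiniteDimensional k (gradedPiece I n) :=
  Submodule.finiteDimensional_of_le (S₂ := homogeneousSubmodule σ k n) inf_le_right

lemma finrank_gradedPiece_sup_span_singleton [Finite σ] {I : Ideal (MvPolynomial σ k)}
    (hI : I.IsHomogeneous (homogeneousSubmodule σ k)) {w : MvPolynomial σ k} {e : ℕ}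
    (hw : w.IsHomogeneous e) (hw0 : w ≠ 0) (hreg : ∀ y, w * y ∈ I → y ∈ I) (n : ℕ) :
    Module.finrank k (gradedPiece (I ⊔ Ideal.span {w}) (n + e)) +
      Module.finrank k (gradedPiece I n) =
    Module.finrank k (gradedPiece I (n + e)) +
      Module.finrank k (homogeneousSubmodule σ k n) := by
  have hinj : Function.Injective (LinearMap.mulLeft k w) :=
    mul_right_injective₀ hw0
  have e1 : gradedPiece (I ⊔ Ideal.span {w}) (n + e) =
      gradedPiece I (n + e) ⊔ (homogeneousSubmodule σ k n).map (LinearMap.mulLeft k w) := by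
    apply le_antisymm
    · rintro x ⟨hx, hxn⟩
      obtain ⟨i, hi, z, hz, rfl⟩ := Submodule.mem_sup.1 hx
      obtain ⟨y, rfl⟩ := Ideal.mem_span_singleton.1 hz
      rw [SetLike.mem_coe, mem_homogeneousSubmodule] at hxn
      rw [← homogeneousComponent_eq_self hxn, map_add,
        homogeneousComponent_mul_of_isHomogeneous hw]
      exact Submodule.add_mem_sup
        ⟨homogeneousComponent_mem_of_mem hI hi _, homogeneousComponent_mem _ _⟩
        ⟨_, homogeneousComponent_mem _ _, rfl⟩
    · apply sup_le
      · rintro x ⟨hx, hxn⟩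
        exact ⟨Ideal.mem_sup_left hx, hxn⟩
      · rintro _ ⟨y, hy, rfl⟩
        refine ⟨Ideal.mem_sup_right (Ideal.mem_span_singleton.2 ⟨y, rfl⟩), ?_⟩
        rw [add_comm]
        exact hw.mul hy
  have e2 : gradedPiece I (n + e) ⊓ (homogeneousSubmodule σ k n).map (LinearMap.mulLeft k w) =
      (gradedPiece I n).map (LinearMap.mulLeft k w) := by
    apply le_antisymm
    · rintro _ ⟨⟨hx, _⟩, y, hy, rfl⟩
      exact ⟨y, ⟨hreg y hx, hy⟩, rfl⟩
    · rintro _ ⟨y, ⟨hy, hyn⟩, rfl⟩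
      refine ⟨⟨I.mul_mem_left _ hy, ?_⟩, y, hyn, rfl⟩
      rw [add_comm]
      exact hw.mul hyn
  have h := Submodule.finrank_sup_add_finrank_inf_eq (gradedPiece I (n + e))
    ((homogeneousSubmodule σ k n).map (LinearMap.mulLeft k w))
  rwa [← e1, e2, LinearEquiv.finrank_eq (Submodule.equivMapOfInjective _ hinj _).symm,
    LinearEquiv.finrank_eq (Submodule.equivMapOfInjective _ hinj _).symm] at h

lemma finrank_homogeneousSubmodule_fin_four (n : ℕ) :
    Module.finrank k (homogeneousSubmodule (Fin 4) k n) = (n + 3).choose 3 := by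
  rw [homogeneousSubmodule_eq_finsupp_supported,
    (AddMonoidAlgebra.supportedEquivFinsupp _).finrank_eq]
  have hs : {d : Fin 4 →₀ ℕ | d.degree = n} =
      ↑(Finset.univ.finsuppAntidiag n : Finset (Fin 4 →₀ ℕ)) := by
    ext d
    simp [Finset.mem_finsuppAntidiag, Finsupp.degree_eq_sum]
  rw [hs, Module.finrank_finsupp_self]
  simp [Finset.card_finsuppAntidiag_nat_eq_choose]
  rw [Nat.add_comm 3 n, Nat.choose_symm_add]

/-- Bézout's count for a regular sequence of three forms in four variables, in terms of the
Hilbert function. -/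
lemma finrank_gradedPiece_complete_intersection {f g h : MvPolynomial (Fin 4) k} {a b c : ℕ}
    (hf : f.IsHomogeneous a) (hg : g.IsHomogeneous b) (hh : h.IsHomogeneous c)
    (hf0 : f ≠ 0) (hg0 : g ≠ 0) (hh0 : h ≠ 0)
    (hfg : ∀ y, f ∣ g * y → f ∣ y)
    (hreg : ∀ y, h * y ∈ Ideal.span {f} ⊔ Ideal.span {g} → y ∈ Ideal.span {f} ⊔ Ideal.span {g})
    (n : ℕ) :
    Module.finrank k
        (gradedPiece (Ideal.span {f} ⊔ Ideal.span {g} ⊔ Ideal.span {h}) (n + a + b + c)) +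
      a * b * c = Module.finrank k (homogeneousSubmodule (Fin 4) k (n + a + b + c)) := by
  have hbot : (⊥ : Ideal (MvPolynomial (Fin 4) k)).IsHomogeneous
      (homogeneousSubmodule (Fin 4) k) := Ideal.IsHomogeneous.bot _
  have hF : (Ideal.span {f}).IsHomogeneous (homogeneousSubmodule (Fin 4) k) :=
    Ideal.homogeneous_span _ _ fun x hx => ⟨a, by rw [Set.mem_singleton_iff.1 hx]; exact hf⟩
  have hG : (Ideal.span {g}).IsHomogeneous (homogeneousSubmodule (Fin 4) k) :=
    Ideal.homogeneous_span _ _ fun x hx => ⟨b, by rw [Set.mem_singleton_iff.1 hx]; exact hg⟩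
  have h0 : ∀ m, Module.finrank k (gradedPiece (⊥ : Ideal (MvPolynomial (Fin 4) k)) m) = 0 := by
    intro m
    have : gradedPiece (⊥ : Ideal (MvPolynomial (Fin 4) k)) m = ⊥ := by
      rw [gradedPiece, eq_bot_iff]
      rintro x ⟨hx, _⟩
      exact hx
    rw [this, finrank_bot]
  have h1 : ∀ m, Module.finrank k (gradedPiece (Ideal.span {f}) (m + a)) = (m + 3).choose 3 := by
    intro m
    have := finrank_gradedPiece_sup_span_singleton hbot hf hf0
      (fun y hy => by simpa [hf0] using hy) m
    rw [bot_sup_eq, h0, h0, finrank_homogeneousSubmodule_fin_four] at this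
    omega
  have h2 : ∀ m, Module.finrank k (gradedPiece (Ideal.span {f} ⊔ Ideal.span {g}) (m + a + b)) +
      (m + 3).choose 3 = (m + b + 3).choose 3 + (m + a + 3).choose 3 := by
    intro m
    have := finrank_gradedPiece_sup_span_singleton hF hg hg0
      (fun y hy => by
        rw [Ideal.mem_span_singleton] at hy ⊢
        exact hfg y hy) (m + a)
    rw [h1, show m + a + b = m + b + a by ring, h1, finrank_homogeneousSubmodule_fin_four] at this
    rw [show m + a + b = m + b + a by ring]
    omega
  have h3 := finrank_gradedPiece_sup_span_singleton (hF.sup hG) hh hh0 hreg (n + a + b)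
  have h4 := h2 n
  have h5 := h2 (n + c)
  rw [show n + c + a + b = n + a + b + c by ring] at h5
  rw [finrank_homogeneousSubmodule_fin_four] at h3 ⊢
  have choose_cast : ∀ m : ℕ, 6 * (((m + 3).choose 3 : ℕ) : ℤ) = (m + 1) * (m + 2) * (m + 3) := by
    intro m
    have : (m + 3).choose 3 * 6 = (m + 3) * (m + 2) * (m + 1) := by
      have := Nat.descFactorial_eq_factorial_mul_choose (m + 3) 3
      simp [Nat.descFactorial, Nat.factorial] at this
      rw [mul_comm, ← this]
      ring
    zify at this
    linarith
  have c0 := choose_cast n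
  have c1 := choose_cast (n + b)
  have c2 := choose_cast (n + a)
  have c3 := choose_cast (n + c)
  have c4 := choose_cast (n + c + b)
  have c5 := choose_cast (n + c + a)
  have c6 := choose_cast (n + a + b)
  have c7 := choose_cast (n + a + b + c)
  push_cast at c0 c1 c2 c3 c4 c5 c6 c7
  zify at h3 h4 h5 ⊢
  linarith

end HilbertFunction

lemma sub_aeval_mem {σ R : Type*} [CommRing R] (I : Ideal (MvPolynomial σ R))
    (x : σ → MvPolynomial σ R) (hx : ∀ i, X i - x i ∈ I) (F : MvPolynomial σ R) :
    F - aeval x F ∈ I := by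
  have h : (Ideal.Quotient.mkₐ R I) = (Ideal.Quotient.mkₐ R I).comp (aeval x) := by
    ext i
    simpa using (Ideal.Quotient.eq.2 (hx i))
  exact Ideal.Quotient.eq.1 (DFunLike.congr_fun h F)

section LinearForms

variable {σ : Type*} [Fintype σ] {K : Type*} [Field K]

/-- The linear form with coefficient vector `c`. -/
def linForm (c : σ → K) : MvPolynomial σ K := ∑ i, C (c i) * X i

lemma aeval_linForm {A : Type*} [CommRing A] [Algebra K A] (c : σ → K) (x : σ → A) :
    aeval x (linForm c) = ∑ i, c i • x i := by
  simp [linForm, Algebra.smul_def]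

@[simp]
lemma eval_linForm (c v : σ → K) : eval v (linForm c) = c ⬝ᵥ v := by
  simp [linForm, dotProduct]

lemma prime_linForm {c v : σ → K} (h : c ⬝ᵥ v = 1) : Prime (linForm c) := by
  have hne : linForm c ≠ 0 := fun h0 => by
    have := eval_linForm c v
    rw [h0, h, map_zero] at this
    exact zero_ne_one this
  set x : σ → MvPolynomial σ K := fun i => X i - v i • linForm c with hx
  have hker : aeval x (linForm c) = 0 := by
    rw [aeval_linForm]
    simp only [hx, smul_sub, Finset.sum_sub_distrib, smul_smul, ← Finset.sum_smul]
    rw [show ∑ i, c i * v i = 1 from h, one_smul, sub_eq_zero]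
    simp [linForm, MvPolynomial.smul_eq_C_mul]
  have hmem : ∀ F, F - aeval x F ∈ Ideal.span {linForm c} := sub_aeval_mem _ _ fun i => by
    simp only [hx, sub_sub_cancel, MvPolynomial.smul_eq_C_mul]
    exact Ideal.mul_mem_left _ _ (Ideal.mem_span_singleton_self _)
  have key : ∀ F, linForm c ∣ F ↔ aeval x F = 0 := fun F => by
    refine ⟨?_, fun h0 => ?_⟩
    · rintro ⟨y, rfl⟩
      rw [map_mul, hker, zero_mul]
    · have := hmem F
      rwa [h0, sub_zero, Ideal.mem_span_singleton] at this
  refine ⟨hne, fun hu => ?_, fun a b hab => ?_⟩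
  · have := hu.map (eval (0 : σ → K))
    rw [eval_linForm, dotProduct_zero] at this
    exact not_isUnit_zero this
  · rw [key] at hab ⊢
    rw [key]
    simpa using hab

lemma mem_span_pair_linForm_of_mul_mem {c₁ c₂ c₃ v₁ v₂ v₃ : σ → K}
    (h₁₁ : c₁ ⬝ᵥ v₁ = 1) (h₁₂ : c₁ ⬝ᵥ v₂ = 0)
    (h₂₁ : c₂ ⬝ᵥ v₁ = 0) (h₂₂ : c₂ ⬝ᵥ v₂ = 1)
    (h₃₁ : c₃ ⬝ᵥ v₁ = 0) (h₃₂ : c₃ ⬝ᵥ v₂ = 0) (h₃₃ : c₃ ⬝ᵥ v₃ = 1)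
    {u : MvPolynomial σ K} (hu : linForm c₃ * u ∈ Ideal.span {linForm c₁, linForm c₂}) :
    u ∈ Ideal.span {linForm c₁, linForm c₂} := by
  set x : σ → MvPolynomial σ K :=
    fun i => X i - (v₁ i • linForm c₁ + v₂ i • linForm c₂) with hx
  have hval : ∀ c : σ → K, aeval x (linForm c) =
      linForm c - ((c ⬝ᵥ v₁) • linForm c₁ + (c ⬝ᵥ v₂) • linForm c₂) := by
    intro c
    rw [aeval_linForm]
    simp only [hx, smul_sub, smul_add, Finset.sum_sub_distrib, Finset.sum_add_distrib, smul_smul,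
      ← Finset.sum_smul]
    simp [linForm, MvPolynomial.smul_eq_C_mul, dotProduct]
  have hmem : ∀ F, F - aeval x F ∈ Ideal.span {linForm c₁, linForm c₂} :=
    sub_aeval_mem _ _ fun i => by
      simp only [hx, sub_sub_cancel, MvPolynomial.smul_eq_C_mul]
      exact Ideal.add_mem _ (Ideal.mul_mem_left _ _ (Ideal.subset_span (by simp)))
        (Ideal.mul_mem_left _ _ (Ideal.subset_span (by simp)))
  have hne : linForm c₃ ≠ 0 := (prime_linForm h₃₃).ne_zero
  have hker : ∀ F ∈ Ideal.span {linForm c₁, linForm c₂}, aeval x F = 0 := by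
    intro F hF
    obtain ⟨a, b, rfl⟩ := Ideal.mem_span_pair.1 hF
    rw [map_add, map_mul, map_mul, hval, hval, h₁₁, h₁₂, h₂₁, h₂₂]
    simp
  have h0 := hker _ hu
  rw [map_mul, hval, h₃₁, h₃₂, zero_smul, zero_smul, add_zero, sub_zero] at h0
  have := hmem u
  rwa [(mul_eq_zero.1 h0).resolve_left hne, sub_zero] at this

end LinearForms

section Exchange

/-- If `p` annihilates a nonzero class modulo the coprime pair `F, G`, then also modulo any coprime
pair `k, G` with `k ∈ p`. -/
lemma exists_annihilated_exchange {R : Type*} [CommRing R] [IsDomain R] [DecompositionMonoid R]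
    {F G k : R} {p : Ideal R} (hFG : IsRelPrime F G) (hkG : IsRelPrime k G) (hk : k ∈ p)
    (h : ∃ u, u ∉ Ideal.span {F, G} ∧ ∀ q ∈ p, q * u ∈ Ideal.span {F, G}) :
    ∃ v, v ∉ Ideal.span {k, G} ∧ ∀ q ∈ p, q * v ∈ Ideal.span {k, G} := by
  obtain ⟨u, hu, hp⟩ := h
  obtain ⟨a, b, hab⟩ := Ideal.mem_span_pair.1 (hp k hk)
  refine ⟨a, fun ha => hu ?_, fun q hq => ?_⟩
  · obtain ⟨s, t, hst⟩ := Ideal.mem_span_pair.1 ha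
    have : G ∣ u - s * F := hkG.symm.dvd_of_dvd_mul_left (y := k)
      ⟨t * F + b, by linear_combination -hab - F * hst⟩
    obtain ⟨r, hr⟩ := this
    exact Ideal.mem_span_pair.2 ⟨s, r, by linear_combination -hr⟩
  · obtain ⟨w, w', hw⟩ := Ideal.mem_span_pair.1 (hp q hq)
    have : G ∣ k * w - q * a := hFG.symm.dvd_of_dvd_mul_left (y := F)
      ⟨q * b - k * w', by linear_combination k * hw - q * hab⟩
    obtain ⟨r, hr⟩ := this
    exact Ideal.mem_span_pair.2 ⟨w, -r, by linear_combination hr⟩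

end Exchange

section Unmixed

variable {K : Type*} [Field K] [Infinite K]

/-- No prime containing all linear forms vanishing at a given point is associated to a complete
intersection of two surfaces. -/
lemma not_annihilated_of_linForm_mem {F G : MvPolynomial (Fin 4) K} (hFG : IsRelPrime F G)
    (hG : G ≠ 0) {p : Ideal (MvPolynomial (Fin 4) K)} {P : Fin 4 → K} (hP : P ≠ 0)
    (hp : ∀ c : Fin 4 → K, c ⬝ᵥ P = 0 → linForm c ∈ p) {u : MvPolynomial (Fin 4) K}
    (hu : u ∉ Ideal.span {F, G}) (h : ∀ q ∈ p, q * u ∈ Ideal.span {F, G}) : False := by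
  classical
  obtain ⟨c₀, hc₀P, v₀, hc₀v₀⟩ : ∃ c₀ : Fin 4 → K, c₀ ⬝ᵥ P = 0 ∧ ∃ v₀, c₀ ⬝ᵥ v₀ ≠ 0 := by
    obtain ⟨j, hj⟩ := Function.ne_iff.1 hP
    obtain ⟨i, hij⟩ := exists_ne j
    refine ⟨Pi.single i (P j) - Pi.single j (P i), ?_, Pi.single i 1, ?_⟩
    · simp [sub_dotProduct, mul_comm]
    · simpa [sub_dotProduct, hij.symm] using hj
  obtain ⟨Q, hQ⟩ : ∃ Q, eval Q (G * linForm c₀) ≠ 0 := by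
    by_contra! hcon
    have h0 : G * linForm c₀ = 0 := MvPolynomial.funext fun x => by rw [hcon x, map_zero]
    refine hc₀v₀ ?_
    rw [← eval_linForm, (mul_eq_zero.1 h0).resolve_left hG, map_zero]
  rw [map_mul, eval_linForm, mul_ne_zero_iff] at hQ
  have hli : LinearIndependent K ![P, Q] := by
    refine LinearIndependent.pair_iff.2 fun s t hst => ?_
    have ht : t = 0 := by
      have := congrArg (c₀ ⬝ᵥ ·) hst
      simpa [dotProduct_add, hc₀P, hQ.2] using this
    refine ⟨?_, ht⟩
    simpa [ht, hP] using hst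
  set b : Module.Basis (Fin 2 ⊕ ↑(Module.Basis.sumExtendIndex hli)) K (Fin 4 → K) :=
    Module.Basis.sumExtend hli with hb
  have hbP : b (Sum.inl 0) = P := by
    simp only [hb, Module.Basis.sumExtend, Module.Basis.reindex_apply,
      Module.Basis.extend_apply_self]
    rfl
  have hbQ : b (Sum.inl 1) = Q := by
    simp only [hb, Module.Basis.sumExtend, Module.Basis.reindex_apply,
      Module.Basis.extend_apply_self]
    rfl
  have : Finite (Fin 2 ⊕ ↑(Module.Basis.sumExtendIndex hli)) := Module.Finite.finite_basis b
  have : Finite ↑(Module.Basis.sumExtendIndex hli) := 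
    Finite.of_injective _ (Sum.inr_injective (α := Fin 2))
  have := Fintype.ofFinite ↑(Module.Basis.sumExtendIndex hli)
  have hcard : Fintype.card ↑(Module.Basis.sumExtendIndex hli) = 2 := by
    have h4 := Module.finrank_eq_nat_card_basis b
    rw [Module.finrank_fintype_fun_eq_card, Nat.card_sum, Nat.card_fin, Fintype.card_fin] at h4
    rw [← Nat.card_eq_fintype_card]
    omega
  let e := (Fintype.equivFinOfCardEq hcard).symm
  set γ : (Fin 2 ⊕ ↑(Module.Basis.sumExtendIndex hli)) → Fin 4 → K :=
    fun i m => b.coord i (Pi.single m 1) with hγ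
  have hcoord : ∀ i v, γ i ⬝ᵥ v = b.coord i v := by
    intro i v
    conv_rhs => rw [pi_eq_sum_univ' v]
    simp [hγ, dotProduct, mul_comm, -Module.Basis.coord_apply]
  have hdual : ∀ i j, γ i ⬝ᵥ b j = if j = i then 1 else 0 := by
    intro i j
    rw [hcoord]
    simp [Finsupp.single_apply]
  have h01 : e 0 ≠ e 1 := by simp
  have hmem : ∀ i, i ≠ Sum.inl 0 → linForm (γ i) ∈ p := fun i hi => hp _ (by
    have := hdual i (.inl 0)
    rwa [hbP, if_neg hi.symm] at this)
  have hk := prime_linForm (c := γ (.inr (e 0))) (v := b (.inr (e 0))) (by simp [hdual])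
  have hl := prime_linForm (c := γ (.inr (e 1))) (v := b (.inr (e 1))) (by simp [hdual])
  have hkG : IsRelPrime (linForm (γ (.inr (e 0)))) G := by
    rw [hk.irreducible.isRelPrime_iff_not_dvd]
    rintro ⟨y, rfl⟩
    refine hQ.1 ?_
    have := hdual (.inr (e 0)) (.inl 1)
    rw [hbQ] at this
    rw [map_mul, eval_linForm, this]
    simp
  have hlk : IsRelPrime (linForm (γ (.inr (e 1)))) (linForm (γ (.inr (e 0)))) := by
    rw [hl.irreducible.isRelPrime_iff_not_dvd]
    rintro ⟨y, hy⟩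
    have := congrArg (eval (b (.inr (e 0)))) hy
    rw [map_mul, eval_linForm, eval_linForm, hdual, hdual] at this
    simp at this
  have h1 := exists_annihilated_exchange hFG hkG (hmem _ (by simp)) ⟨u, hu, h⟩
  rw [Ideal.span_pair_comm] at h1
  obtain ⟨w, hw, hw'⟩ := exists_annihilated_exchange hkG.symm hlk (hmem _ (by simp)) h1
  refine hw ?_
  rw [Ideal.span_pair_comm] at hw' ⊢
  refine mem_span_pair_linForm_of_mul_mem (v₁ := b (.inr (e 0))) (v₂ := b (.inr (e 1)))
    (v₃ := b (.inl 1)) ?_ ?_ ?_ ?_ ?_ ?_ ?_ (hw' _ (hmem (.inl 1) (by simp))) <;>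
  simp [hdual]

end Unmixed

/-- A prime ideal whose zero locus consists of finitely many lines through the origin contains all
linear forms vanishing on one of them. -/
lemma exists_linForm_mem_of_zeroLocus_subset {K : Type*} [Field K] [IsAlgClosed K] {n : ℕ}
    {p : Ideal (MvPolynomial (Fin n) K)} [p.IsPrime] {T : Finset (Fin n → K)}
    (hT : ∀ v, (∀ F ∈ p, eval v F = 0) → ∃ P ∈ T, ∃ t : K, v = t • P) :
    ∃ P ∈ T, ∀ c : Fin n → K, c ⬝ᵥ P = 0 → linForm c ∈ p := by
  by_contra! hcon
  choose! c hc hcp using hcon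
  have hmem : ∏ P ∈ T, linForm (c P) ∈ p := by
    rw [← MvPolynomial.IsPrime.vanishingIdeal_zeroLocus (K := K) p, mem_vanishingIdeal_iff]
    intro v hv
    obtain ⟨P, hPT, t, rfl⟩ := hT v fun F hF => by
      simpa [aeval_eq_eval] using mem_zeroLocus_iff.1 hv F hF
    rw [map_prod]
    refine Finset.prod_eq_zero hPT ?_
    rw [aeval_linForm]
    have := hc P hPT
    have h2 : c P ⬝ᵥ (t • P) = 0 := by rw [dotProduct_smul, this, smul_zero]
    simpa [dotProduct] using h2
  obtain ⟨P, hPT, hP⟩ := (Ideal.IsPrime.prod_mem_iff).1 hmem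
  exact hcp P hPT hP

section AssociatedPrimes

variable {R : Type*} [CommRing R] [IsNoetherianRing R]

lemma exists_mem_iff_of_isAssociatedPrime_quotient {I p : Ideal R}
    (h : IsAssociatedPrime p (R ⧸ I)) : ∃ u, u ∉ I ∧ ∀ q, q ∈ p ↔ q * u ∈ I := by
  obtain ⟨hp, x, hx⟩ := isAssociatedPrime_iff.1 h
  obtain ⟨u, rfl⟩ := Ideal.Quotient.mk_surjective x
  have key : ∀ q, q ∈ p ↔ q * u ∈ I := fun q => by
    rw [hx, Submodule.mem_colon_singleton, Submodule.mem_bot, ← Ideal.Quotient.eq_zero_iff_mem,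
      map_mul]
    rfl
  refine ⟨u, fun hu => hp.ne_top ?_, key⟩
  rw [Ideal.eq_top_iff_one, key, one_mul]
  exact hu

lemma exists_isAssociatedPrime_quotient_mem {I : Ideal R} {x y : R} (hy : y ∉ I)
    (hxy : x * y ∈ I) : ∃ p : Ideal R, IsAssociatedPrime p (R ⧸ I) ∧ x ∈ p := by
  obtain ⟨p, hp, hle⟩ := exists_le_isAssociatedPrime_of_isNoetherianRing R
    (Ideal.Quotient.mk I y) (by rwa [Ne, Ideal.Quotient.eq_zero_iff_mem])
  refine ⟨p, hp, hle ?_⟩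
  rw [Submodule.mem_colon_singleton, Submodule.mem_bot]
  change Ideal.Quotient.mk I x * Ideal.Quotient.mk I y = 0
  rwa [← map_mul, Ideal.Quotient.eq_zero_iff_mem]

/-- A linear system without base component avoids finitely many ideals. -/
lemma exists_sum_smul_notMem {k A ι : Type*} [Field k] [Infinite k] [CommRing A] [Algebra k A]
    [Fintype ι] (x : ι → A) {s : Set (Ideal A)} (hs : s.Finite)
    (h : ∀ p ∈ s, ∃ i, x i ∉ p) : ∃ c : ι → k, ∀ p ∈ s, ∑ i, c i • x i ∉ p := by
  classical
  let V : Ideal A → Subspace k (ι → k) := fun p =>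
    (p.restrictScalars k).comap (Fintype.linearCombination k x)
  have hV : ⊤ ∉ hs.toFinset.image V := by
    simp only [Finset.mem_image, Set.Finite.mem_toFinset, not_exists, not_and]
    intro p hp htop
    obtain ⟨i, hi⟩ := h p hp
    have hmem : Pi.single i 1 ∈ V p := htop ▸ Submodule.mem_top
    refine hi ?_
    simpa [V, Fintype.linearCombination_apply_single] using hmem
  have := Subspace.biUnion_ne_univ_of_top_notMem hV
  obtain ⟨c, hc⟩ := (Set.ne_univ_iff_exists_notMem _).1 this
  refine ⟨c, fun p hp hcp => hc ?_⟩
  refine Set.mem_biUnion (x := V p) ?_ ?_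
  · exact Finset.mem_coe.2 (Finset.mem_image_of_mem _ (hs.mem_toFinset.2 hp))
  · simpa [V, Fintype.linearCombination_apply] using hcp

end AssociatedPrimes

/-- A nonunit factor of a nonzero form has no constant term. -/
lemma constantCoeff_eq_zero_of_mul_isHomogeneous {σ K : Type*} [Field K]
    {s r : MvPolynomial σ K} {d : ℕ} (h : (s * r).IsHomogeneous d) (h0 : s * r ≠ 0)
    (hs : ¬ IsUnit s) : constantCoeff s = 0 := by
  by_contra hc
  let E : MvPolynomial σ K →ₐ[K] Polynomial (MvPolynomial σ K) :=
    aeval fun i => Polynomial.C (X i) * Polynomial.X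
  have hE1 : ∀ F, (E F).eval 1 = F := fun F => by
    have : (((Polynomial.aeval (1 : MvPolynomial σ K)).restrictScalars K).comp E) =
        AlgHom.id K _ := by
      ext i
      simp [E]
    simpa [Polynomial.aeval_def, Polynomial.eval₂_eq_eval_map] using DFunLike.congr_fun this F
  have hE0 : ∀ F, (E F).eval 0 = C (constantCoeff F) := fun F => by
    have : (Polynomial.evalRingHom 0).comp E.toRingHom =
        (C : K →+* MvPolynomial σ K).comp constantCoeff := by
      ext i <;> simp [E]
    exact DFunLike.congr_fun this F
  have hEh : ∀ F, F.IsHomogeneous d → E F = Polynomial.C F * Polynomial.X ^ d := by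
    intro F hF
    conv_lhs => rw [F.as_sum]
    conv_rhs => rw [F.as_sum]
    rw [map_sum, map_sum, Finset.sum_mul]
    refine Finset.sum_congr rfl fun m hm => ?_
    have hdeg := hF (mem_support_iff.1 hm)
    rw [Finsupp.weight_apply, Finsupp.sum] at hdeg
    simp only [Pi.one_apply, smul_eq_mul, mul_one] at hdeg
    rw [aeval_monomial, monomial_eq, Finsupp.prod, Finsupp.prod]
    simp_rw [mul_pow]
    rw [Finset.prod_mul_distrib, Finset.prod_pow_eq_pow_sum, hdeg, map_mul, map_prod, mul_assoc]
    simp [Polynomial.algebraMap_apply, MvPolynomial.algebraMap_eq]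
  have hX : ¬ (Polynomial.X : Polynomial (MvPolynomial σ K)) ∣ E s := by
    rw [Polynomial.X_dvd_iff, Polynomial.coeff_zero_eq_eval_zero, hE0]
    simpa using hc
  have hsr : E s * E r = Polynomial.C (s * r) * Polynomial.X ^ d := by rw [← map_mul, hEh _ h]
  obtain ⟨q, hq⟩ := Polynomial.prime_X.pow_dvd_of_dvd_mul_left d hX ⟨_, hsr.trans (mul_comm _ _)⟩
  have hC : E s * q = Polynomial.C (s * r) := by
    refine mul_right_cancel₀ (pow_ne_zero d Polynomial.X_ne_zero) ?_
    rw [← hsr, hq]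
    ring
  have hdeg : (E s).natDegree = 0 := by
    have h1 := congrArg Polynomial.natDegree hC
    have hne : E s * q ≠ 0 := by rw [hC]; simpa using h0
    rw [Polynomial.natDegree_mul (left_ne_zero_of_mul hne) (right_ne_zero_of_mul hne),
      Polynomial.natDegree_C] at h1
    omega
  obtain ⟨a, ha⟩ := Polynomial.natDegree_eq_zero.1 hdeg
  have ha1 := hE1 s
  have ha0 := hE0 s
  rw [← ha, Polynomial.eval_C] at ha1 ha0
  refine hs ?_
  rw [← ha1, ha0]
  exact (IsUnit.mk0 _ hc).map C

/-- A principal prime ideal does not contain all the linear forms vanishing at a point. -/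
lemma exists_linForm_not_dvd {K : Type*} [Field K] {s : MvPolynomial (Fin 4) K} (hs : ¬ IsUnit s)
    {P : Fin 4 → K} (hP : P ≠ 0) : ∃ c : Fin 4 → K, c ⬝ᵥ P = 0 ∧ ¬ s ∣ linForm c := by
  by_contra! hcon
  obtain ⟨j, hj⟩ := Function.ne_iff.1 hP
  obtain ⟨i, k, hij, hkj, hik⟩ : ∃ i k : Fin 4, i ≠ j ∧ k ≠ j ∧ i ≠ k := by
    clear hj
    revert j
    decide
  let c : Fin 4 → Fin 4 → K := fun i => Pi.single i 1 - Pi.single j (P i / P j)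
  have hc : ∀ i, c i ⬝ᵥ P = 0 := fun i => by
    simp [c, sub_dotProduct, div_mul_cancel₀ _ hj]
  have hv : ∀ i l, l ≠ j → c i ⬝ᵥ Pi.single l 1 = if i = l then 1 else 0 := fun i l hl => by
    simp [c, hl, Pi.single_apply, eq_comm]
  have hi : Prime (linForm (c i)) := prime_linForm (v := Pi.single i 1) (by simp [hv, hij])
  obtain ⟨r, hr⟩ := hcon _ (hc i)
  obtain ⟨q, hq⟩ := hcon _ (hc k)
  have hu := (hi.irreducible.isUnit_or_isUnit hr).resolve_left hs
  obtain ⟨t, ht⟩ : linForm (c i) ∣ linForm (c k) := by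
    rw [hr, hu.mul_right_dvd]
    exact ⟨q, hq⟩
  have := congrArg (eval (Pi.single k 1)) ht
  rw [map_mul, eval_linForm, eval_linForm, hv _ _ hkj, hv _ _ hkj] at this
  simp [hik] at this

section Polars

variable {K : Type*} [Field K] [IsAlgClosed K] {f : MvPolynomial (Fin 4) K}
  {T : Finset (Fin 4 → K)}

lemma exists_pderiv_notMem_of_isAssociatedPrime (hT0 : ∀ P ∈ T, P ≠ 0)
    (hT : ∀ v, (∀ i, eval v (pderiv i f) = 0) → ∃ P ∈ T, ∃ t : K, v = t • P)
    {F G : MvPolynomial (Fin 4) K} (hFG : IsRelPrime F G) (hG : G ≠ 0)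
    {p : Ideal (MvPolynomial (Fin 4) K)}
    (hp : IsAssociatedPrime p (MvPolynomial (Fin 4) K ⧸ Ideal.span {F, G})) :
    ∃ i, pderiv i f ∉ p := by
  by_contra! hcon
  have : Infinite K := IsAlgClosed.instInfinite
  have := hp.isPrime
  obtain ⟨P, hPT, hP⟩ := exists_linForm_mem_of_zeroLocus_subset (p := p) (T := T)
    fun v hv => hT v fun i => hv _ (hcon i)
  obtain ⟨u, hu, hup⟩ := exists_mem_iff_of_isAssociatedPrime_quotient hp
  exact not_annihilated_of_linForm_mem hFG hG (hT0 P hPT) hP hu fun q hq => (hup q).1 hq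

/-- A surface with finitely many singular points has no common component with a surface of smaller
degree. -/
lemma isRelPrime_of_totalDegree_lt (hT0 : ∀ P ∈ T, P ≠ 0)
    (hT : ∀ v, (∀ i, eval v (pderiv i f) = 0) → ∃ P ∈ T, ∃ t : K, v = t • P)
    (hf0 : f ≠ 0) {d : ℕ} (hf : f.IsHomogeneous d) {g : MvPolynomial (Fin 4) K} (hg0 : g ≠ 0)
    (hdeg : g.totalDegree < d) : IsRelPrime f g := by
  refine WfDvdMonoid.isRelPrime_of_no_irreducible_factors (by simp [hf0]) fun s hs hsf hsg => ?_
  obtain ⟨r, hr⟩ := hsf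
  have hru : ¬ IsUnit r := fun hu => by
    have h1 : f ∣ g := by rwa [hr, hu.mul_right_dvd]
    have h2 := totalDegree_le_of_dvd_of_isDomain h1 hg0
    rw [hf.totalDegree hf0] at h2
    omega
  have hr0 : r ≠ 0 := by
    rintro rfl
    exact hf0 (by rw [hr, mul_zero])
  by_cases hsr : s ∣ r
  · have hmem : ∀ i, pderiv i f ∈ Ideal.span {s} := fun i => by
      rw [Ideal.mem_span_singleton, hr, pderiv_mul]
      exact dvd_add (hsr.mul_left _) (dvd_mul_right _ _)
    have : (Ideal.span {s}).IsPrime := (Ideal.span_singleton_prime hs.ne_zero).2 hs.prime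
    obtain ⟨P, hPT, hP⟩ := exists_linForm_mem_of_zeroLocus_subset (p := Ideal.span {s}) (T := T)
      fun v hv => hT v fun i => hv _ (hmem i)
    obtain ⟨c, hc, hcs⟩ := exists_linForm_not_dvd hs.not_isUnit (hT0 P hPT)
    exact hcs (Ideal.mem_span_singleton.1 (hP c hc))
  · have hne : (1 : MvPolynomial (Fin 4) K) ∉ Ideal.span {s, r} := fun h1 => by
      obtain ⟨a, b, hab⟩ := Ideal.mem_span_pair.1 h1
      have hs0 := constantCoeff_eq_zero_of_mul_isHomogeneous (hr ▸ hf) (hr ▸ hf0) hs.not_isUnit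
      rw [mul_comm] at hr
      have hr0 := constantCoeff_eq_zero_of_mul_isHomogeneous (hr ▸ hf) (hr ▸ hf0) hru
      have := congrArg constantCoeff hab
      rw [map_add, map_mul, map_mul, hs0, hr0] at this
      simp at this
    have hrel : IsRelPrime s r := hs.isRelPrime_iff_not_dvd.2 hsr
    obtain ⟨p, hp, -⟩ := exists_isAssociatedPrime_quotient_mem (x := 0) hne (by simp)
    obtain ⟨u, hu, hup⟩ := exists_mem_iff_of_isAssociatedPrime_quotient hp
    obtain ⟨i, hi⟩ := exists_pderiv_notMem_of_isAssociatedPrime hT0 hT hrel hr0 hp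
    have hsp : s ∈ p := (hup s).2 (Ideal.mul_mem_right _ _ (Ideal.subset_span (by simp)))
    have hrp : r ∈ p := (hup r).2 (Ideal.mul_mem_right _ _ (Ideal.subset_span (by simp)))
    refine hi ?_
    rw [hr, pderiv_mul]
    exact Ideal.add_mem _ (Ideal.mul_mem_left _ _ hrp) (Ideal.mul_mem_right _ _ hsp)

/-- Some first polar of a surface with finitely many singular points completes a coprime pair to a
regular sequence. -/
lemma exists_polar_regular (hT0 : ∀ P ∈ T, P ≠ 0)
    (hT : ∀ v, (∀ i, eval v (pderiv i f) = 0) → ∃ P ∈ T, ∃ t : K, v = t • P)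
    {F G : MvPolynomial (Fin 4) K} (hFG : IsRelPrime F G) (hG : G ≠ 0) :
    ∃ c : Fin 4 → K, ∀ y, (∑ i, c i • pderiv i f) * y ∈ Ideal.span {F, G} →
      y ∈ Ideal.span {F, G} := by
  have : Infinite K := IsAlgClosed.instInfinite
  obtain ⟨c, hc⟩ := exists_sum_smul_notMem (k := K) (fun i => pderiv i f)
    (associatedPrimes.finite (MvPolynomial (Fin 4) K)
      (MvPolynomial (Fin 4) K ⧸ Ideal.span {F, G}))
    fun p hp => exists_pderiv_notMem_of_isAssociatedPrime hT0 hT hFG hG hp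
  refine ⟨c, fun y hy => ?_⟩
  by_contra hcon
  obtain ⟨p, hp, hpc⟩ := exists_isAssociatedPrime_quotient_mem hcon hy
  exact hc p hp hpc

end Polars

section LocalAlgebra

variable {K : Type*} [Field K]

/-- The exponents of the monomials of degree `< k` in three variables. -/
def lowExponents (k : ℕ) : Finset (Fin 3 →₀ ℕ) :=
  (Finset.range k).biUnion fun n => Finset.univ.finsuppAntidiag n

lemma mem_lowExponents {k : ℕ} {m : Fin 3 →₀ ℕ} : m ∈ lowExponents k ↔ m.degree < k := by
  simp [lowExponents, Finset.mem_finsuppAntidiag, Finsupp.degree_eq_sum]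

lemma card_lowExponents (k : ℕ) :
    (lowExponents k).card = ∑ n ∈ Finset.range k, (n + 2).choose 2 := by
  rw [lowExponents, Finset.card_biUnion]
  · refine Finset.sum_congr rfl fun n _ => ?_
    rw [Finset.card_finsuppAntidiag_nat_eq_choose, Finset.card_univ, Fintype.card_fin,
      ← Nat.choose_symm_add]
    congr 1
    omega
  · intro a _ b _ hab
    refine Finset.disjoint_left.2 fun m hm hm' => hab ?_
    simp only [Finset.mem_finsuppAntidiag] at hm hm'
    exact hm.1.symm.trans hm'.1

variable (K) in
/-- The coefficients of degree `< k`. -/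
def lowCoeffs (k : ℕ) : MvPolynomial (Fin 3) K →ₗ[K] (lowExponents k → K) :=
  LinearMap.pi fun m => lcoeff K m.1

variable (K) in
/-- The polynomial of degree `< k` with given coefficients. -/
def ofLowCoeffs (k : ℕ) : (lowExponents k → K) →ₗ[K] MvPolynomial (Fin 3) K :=
  Fintype.linearCombination K fun m => monomial m.1 1

lemma lowCoeffs_ofLowCoeffs (k : ℕ) (v : lowExponents k → K) :
    lowCoeffs K k (ofLowCoeffs K k v) = v := by
  classical
  ext m
  simp [lowCoeffs, ofLowCoeffs, Fintype.linearCombination_apply, coeff_monomial,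
    Subtype.ext_iff.symm]

lemma lowCoeffs_eq_zero_iff {k : ℕ} {x : MvPolynomial (Fin 3) K} :
    lowCoeffs K k x = 0 ↔ x ∈ idealOfVars (Fin 3) K ^ k := by
  rw [mem_pow_idealOfVars_iff', funext_iff]
  simp [lowCoeffs, mem_lowExponents]

lemma sub_ofLowCoeffs_mem (k : ℕ) (x : MvPolynomial (Fin 3) K) :
    x - ofLowCoeffs K k (lowCoeffs K k x) ∈ idealOfVars (Fin 3) K ^ k := by
  rw [← lowCoeffs_eq_zero_iff, map_sub, lowCoeffs_ofLowCoeffs, sub_self]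

lemma sub_ofLowCoeffs_mul_mem {k l n : ℕ} (hn : n ≤ k + l) (x : MvPolynomial (Fin 3) K)
    {y : MvPolynomial (Fin 3) K} (hy : y ∈ idealOfVars (Fin 3) K ^ l) :
    x * y - ofLowCoeffs K k (lowCoeffs K k x) * y ∈ idealOfVars (Fin 3) K ^ n := by
  rw [← sub_mul]
  exact Ideal.pow_le_pow_right hn (pow_add (idealOfVars (Fin 3) K) k l ▸
    Ideal.mul_mem_mul (sub_ofLowCoeffs_mem k x) hy)

/-- The ideal generated modulo degree `4` by elements of order at least `3, 2, 1` has colength at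
least `6`. -/
lemma six_le_finrank_quotient {F G H : MvPolynomial (Fin 3) K}
    (hF : F ∈ idealOfVars (Fin 3) K ^ 3) (hH : H ∈ idealOfVars (Fin 3) K ^ 2)
    (hG : G ∈ idealOfVars (Fin 3) K ^ 1) {J : Ideal (MvPolynomial (Fin 3) K)}
    (hJ : J = idealOfVars (Fin 3) K ^ 4 ⊔ Ideal.span {F, G, H}) :
    FiniteDimensional K (MvPolynomial (Fin 3) K ⧸ J) ∧
      6 ≤ Module.finrank K (MvPolynomial (Fin 3) K ⧸ J) := by
  have hmJ : idealOfVars (Fin 3) K ^ 4 ≤ J := hJ ▸ le_sup_left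
  let Ψ : ((lowExponents 1 → K) × (lowExponents 2 → K) × (lowExponents 3 → K)) →ₗ[K]
      MvPolynomial (Fin 3) K :=
    (LinearMap.mulRight K F ∘ₗ ofLowCoeffs K 1).coprod
      ((LinearMap.mulRight K H ∘ₗ ofLowCoeffs K 2).coprod
        (LinearMap.mulRight K G ∘ₗ ofLowCoeffs K 3))
  have hΨ : ∀ a b c, Ψ (a, b, c) =
      ofLowCoeffs K 1 a * F + (ofLowCoeffs K 2 b * H + ofLowCoeffs K 3 c * G) := fun _ _ _ => rfl
  let Φ := lowCoeffs K 4 ∘ₗ Ψ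
  have hcard : ∀ k, Module.finrank K (lowExponents k → K) =
      ∑ n ∈ Finset.range k, (n + 2).choose 2 := fun k => by
    rw [Module.finrank_fintype_fun_eq_card, Fintype.card_coe, card_lowExponents]
  have hker : LinearMap.ker Φ ≠ ⊥ := by
    rw [Submodule.ne_bot_iff]
    have hmem : ∀ v, v ∈ LinearMap.ker Φ ↔ Ψ v ∈ idealOfVars (Fin 3) K ^ 4 := fun v => by
      rw [LinearMap.mem_ker, LinearMap.comp_apply, lowCoeffs_eq_zero_iff]
    by_cases hG2 : G ∈ idealOfVars (Fin 3) K ^ 2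
    · refine ⟨(0, 0, lowCoeffs K 3 (X 0 ^ 2)), ?_, ?_⟩
      · rw [hmem, hΨ]
        have h1 := sub_ofLowCoeffs_mul_mem (k := 3) (n := 4) (by norm_num) (X 0 ^ 2) hG
        have h2 : X 0 ^ 2 * G ∈ idealOfVars (Fin 3) K ^ 4 := by
          rw [show 4 = 2 + 2 from rfl, pow_add]
          exact Ideal.mul_mem_mul
            (Ideal.pow_mem_pow (Ideal.subset_span (Set.mem_range_self 0)) 2) hG2
        simpa using Ideal.sub_mem _ h2 h1
      · simp only [ne_eq, Prod.mk_eq_zero, true_and, lowCoeffs_eq_zero_iff]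
        rw [X_pow_eq_monomial, monomial_mem_pow_idealOfVars_iff _ _ one_ne_zero]
        simp
    · refine ⟨(0, lowCoeffs K 2 G, - lowCoeffs K 3 H), ?_, ?_⟩
      · rw [hmem, hΨ]
        have h1 := sub_ofLowCoeffs_mul_mem (k := 2) (n := 4) (by norm_num) G hH
        have h2 := sub_ofLowCoeffs_mul_mem (k := 3) (n := 4) (by norm_num) H hG
        have h3 := Ideal.sub_mem _ h2 h1
        convert h3 using 1
        simp only [map_zero, map_neg]
        ring
      · simp [lowCoeffs_eq_zero_iff, hG2]
  have hkerpos := Submodule.one_le_finrank_iff.2 hker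
  have hrn := Φ.finrank_range_add_finrank_ker
  rw [Module.finrank_prod, Module.finrank_prod, hcard, hcard, hcard] at hrn
  have hsum : ∑ n ∈ Finset.range 1, (n + 2).choose 2 + (∑ n ∈ Finset.range 2, (n + 2).choose 2 +
    ∑ n ∈ Finset.range 3, (n + 2).choose 2) = 15 := by decide
  have hsum4 : ∑ n ∈ Finset.range 4, (n + 2).choose 2 = 20 := by decide
  have hcod := (LinearMap.range Φ).finrank_quotient_add_finrank
  rw [hcard, hsum4] at hcod
  let Θ : MvPolynomial (Fin 3) K →ₗ[K] (lowExponents 4 → K) ⧸ LinearMap.range Φ :=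
    (LinearMap.range Φ).mkQ ∘ₗ lowCoeffs K 4
  have hΘ : J.restrictScalars K ≤ LinearMap.ker Θ := by
    intro x hx
    rw [Submodule.restrictScalars_mem, hJ, Submodule.mem_sup] at hx
    obtain ⟨e, he, y, hy, rfl⟩ := hx
    obtain ⟨a, c, b, rfl⟩ := Submodule.mem_span_triple.1 hy
    simp only [smul_eq_mul] at *
    have h1 := sub_ofLowCoeffs_mul_mem (k := 1) (n := 4) (by norm_num) a hF
    have h2 := sub_ofLowCoeffs_mul_mem (k := 2) (n := 4) (by norm_num) b hH
    have h3 := sub_ofLowCoeffs_mul_mem (k := 3) (n := 4) (by norm_num) c hG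
    have h4 : (e + (a * F + c * G + b * H)) -
        Ψ (lowCoeffs K 1 a, lowCoeffs K 2 b, lowCoeffs K 3 c) ∈ idealOfVars (Fin 3) K ^ 4 := by
      rw [hΨ]
      convert Ideal.add_mem _ he (Ideal.add_mem _ h1 (Ideal.add_mem _ h2 h3)) using 1
      ring
    rw [← lowCoeffs_eq_zero_iff, map_sub, sub_eq_zero] at h4
    rw [LinearMap.mem_ker, LinearMap.comp_apply, Submodule.mkQ_apply,
      Submodule.Quotient.mk_eq_zero, h4]
    exact ⟨_, rfl⟩
  have hfin : FiniteDimensional K (MvPolynomial (Fin 3) K ⧸ J) := by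
    refine Module.Finite.of_surjective ((Ideal.Quotient.mkₐ K J).toLinearMap ∘ₗ ofLowCoeffs K 4) ?_
    intro q
    obtain ⟨x, rfl⟩ := Ideal.Quotient.mk_surjective q
    exact ⟨lowCoeffs K 4 x, (Ideal.Quotient.eq.2 (hmJ (sub_ofLowCoeffs_mem 4 x))).symm⟩
  refine ⟨hfin, ?_⟩
  have hsurj : Function.Surjective ((J.restrictScalars K).liftQ Θ hΘ) := by
    intro q
    obtain ⟨v, rfl⟩ := Submodule.mkQ_surjective _ q
    exact ⟨Submodule.Quotient.mk (ofLowCoeffs K 4 v), by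
      simp [Θ, lowCoeffs_ofLowCoeffs]⟩
  have hfin' : FiniteDimensional K (MvPolynomial (Fin 3) K ⧸ J.restrictScalars K) := hfin
  have hle := LinearMap.finrank_le_finrank_of_surjective hsurj
  have heq : Module.finrank K (MvPolynomial (Fin 3) K ⧸ J.restrictScalars K) =
    Module.finrank K (MvPolynomial (Fin 3) K ⧸ J) := rfl
  omega

end LocalAlgebra

section Charts

lemma pderiv_aeval {σ τ R : Type*} [Fintype σ] [CommRing R] (x : σ → MvPolynomial τ R) (j : τ)
    (F : MvPolynomial σ R) :
    pderiv j (aeval x F) = ∑ i, aeval x (pderiv i F) * pderiv j (x i) := by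
  classical
  induction F using MvPolynomial.induction_on with
  | C a => simp [algebraMap_eq]
  | add p q hp hq => simp only [map_add, hp, hq, add_mul, Finset.sum_add_distrib]
  | mul_X p i hp =>
    simp only [map_mul, aeval_X, pderiv_mul, hp, map_add, add_mul, Finset.sum_add_distrib,
      Finset.sum_mul]
    congr 1
    · exact Finset.sum_congr rfl fun _ _ => by ring
    · simp [pderiv_X, Pi.single_apply, apply_ite]

lemma mem_idealOfVars_pow_succ {σ K : Type*} [Field K] [CharZero K] {k : ℕ}
    {F : MvPolynomial σ K} (h0 : constantCoeff F = 0)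
    (h : ∀ j, pderiv j F ∈ idealOfVars σ K ^ k) : F ∈ idealOfVars σ K ^ (k + 1) := by
  classical
  rw [mem_pow_idealOfVars_iff']
  intro m hm
  by_cases hm0 : m = 0
  · rw [hm0]
    exact h0
  obtain ⟨j, hj⟩ := Finsupp.ne_iff.1 hm0
  have hle : Finsupp.single j 1 ≤ m := by
    rw [Finsupp.single_le_iff]
    exact Nat.one_le_iff_ne_zero.2 hj
  obtain ⟨n, rfl⟩ := exists_add_of_le hle
  rw [add_comm] at hm ⊢
  have := (mem_pow_idealOfVars_iff' _ _).1 (h j) n (by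
    rw [map_add, Finsupp.degree_single] at hm
    omega)
  rw [coeff_pderiv] at this
  exact (mul_eq_zero.1 this).resolve_right (Nat.cast_add_one_ne_zero _)

lemma MultAtLeast.eval_eq_zero {n m : ℕ} {F : MvPolynomial (Fin n) ℂ} {p : Fin n → ℂ}
    (h : MultAtLeast F p (m + 1)) : eval p F = 0 := h [] (Nat.succ_pos m)

lemma MultAtLeast.pderiv {n m : ℕ} {F : MvPolynomial (Fin n) ℂ} {p : Fin n → ℂ}
    (h : MultAtLeast F p (m + 1)) (i : Fin n) : MultAtLeast (pderiv i F) p m :=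
  fun l hl => h (i :: l) (Nat.succ_lt_succ hl)

lemma MultAtLeast.aeval_mem {n k : ℕ} {σ : Type*} {p : Fin n → ℂ}
    {x : Fin n → MvPolynomial σ ℂ} (hx : ∀ i, constantCoeff (x i) = p i)
    {F : MvPolynomial (Fin n) ℂ} (h : MultAtLeast F p k) :
    aeval x F ∈ idealOfVars σ ℂ ^ k := by
  induction k generalizing F with
  | zero => simp
  | succ k ih =>
    refine mem_idealOfVars_pow_succ ?_ fun j => ?_
    · have : constantCoeff.comp (aeval x).toRingHom = (eval p : MvPolynomial (Fin n) ℂ →+* ℂ) := by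
        ext i <;> simp [hx]
      exact (DFunLike.congr_fun this F).trans h.eval_eq_zero
    · rw [pderiv_aeval]
      exact Ideal.sum_mem _ fun i _ => Ideal.mul_mem_right _ _ (ih (h.pderiv i))

/-- A chart at a point of projective space. -/
lemma exists_chart {c₀ p : Fin 4 → ℂ} (h : c₀ ⬝ᵥ p = 1) :
    ∃ φ : MvPolynomial (Fin 4) ℂ →ₐ[ℂ] MvPolynomial (Fin 3) ℂ, Function.Surjective φ ∧
      φ (linForm c₀) = 1 ∧ (∀ F k, MultAtLeast F p k → φ F ∈ idealOfVars (Fin 3) ℂ ^ k) ∧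
      ∀ c : Fin 4 → ℂ, c ⬝ᵥ p = 0 → φ (linForm c) ∈ idealOfVars (Fin 3) ℂ := by
  classical
  let Λ : (Fin 4 → ℂ) →ₗ[ℂ] ℂ := dotProductBilin ℂ ℂ c₀
  have hΛ : ∀ v, Λ v = c₀ ⬝ᵥ v := fun _ => rfl
  have hrank : Module.finrank ℂ (LinearMap.ker Λ) = 3 := by
    have h1 := Module.Dual.finrank_ker_add_one_of_ne_zero (f := Λ) (fun h0 => by
      have := hΛ p
      rw [h, h0] at this
      exact zero_ne_one this)
    rw [Module.finrank_fintype_fun_eq_card, Fintype.card_fin] at h1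
    omega
  let b := Module.finBasisOfFinrankEq ℂ (LinearMap.ker Λ) hrank
  let x : Fin 4 → MvPolynomial (Fin 3) ℂ := fun i => C (p i) + ∑ j, C ((b j : Fin 4 → ℂ) i) * X j
  have hlin : ∀ c : Fin 4 → ℂ, aeval x (linForm c) =
      C (c ⬝ᵥ p) + ∑ j, C (c ⬝ᵥ (b j : Fin 4 → ℂ)) * X j := by
    intro c
    rw [aeval_linForm]
    simp only [x, smul_add, Finset.sum_add_distrib, Finset.smul_sum, MvPolynomial.smul_eq_C_mul,
      dotProduct, map_sum, Finset.sum_mul, map_mul]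
    rw [Finset.sum_comm]
    simp only [mul_assoc]
  refine ⟨aeval x, ?_, ?_, fun F k hF => hF.aeval_mem fun i => by simp [x], ?_⟩
  · let M : Fin 3 → (Fin 4 → ℂ) →ₗ[ℂ] ℂ := fun j =>
      b.coord j ∘ₗ (LinearMap.id - Λ.smulRight p).codRestrict (LinearMap.ker Λ) fun v => by
        simp [hΛ, h]
    have hM : ∀ (j : Fin 3) (v : Fin 4 → ℂ), (fun i => M j (Pi.single i 1)) ⬝ᵥ v = M j v := by
      intro j v
      conv_rhs => rw [pi_eq_sum_univ' v]
      simp only [map_sum, map_smul, smul_eq_mul, dotProduct, mul_comm]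
    have hX : ∀ j, aeval x (linForm fun i => M j (Pi.single i 1)) = X j := by
      intro j
      have h1 : M j p = 0 := by
        have : (LinearMap.id - Λ.smulRight p).codRestrict (LinearMap.ker Λ) (fun v => by
          simp [hΛ, h]) p = 0 := by
          ext1
          simp [hΛ, h]
        simp only [M, LinearMap.comp_apply, this, map_zero]
      have h2 : ∀ k, M j (b k) = if k = j then 1 else 0 := by
        intro k
        have : (LinearMap.id - Λ.smulRight p).codRestrict (LinearMap.ker Λ) (fun v => by
          simp [hΛ, h]) (b k) = b k := by
          ext1
          simp [LinearMap.mem_ker.1 (b k).2]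
        simp only [M, LinearMap.comp_apply, this]
        simp [Finsupp.single_apply]
      rw [hlin, hM, h1]
      simp [hM, h2]
    intro F
    refine ⟨aeval (fun j => linForm fun i => M j (Pi.single i 1)) F, ?_⟩
    have : (aeval x).comp (aeval fun j => linForm fun i => M j (Pi.single i 1)) =
        AlgHom.id ℂ (MvPolynomial (Fin 3) ℂ) := by
      refine MvPolynomial.algHom_ext fun j => ?_
      rw [AlgHom.comp_apply, aeval_X, hX]
      rfl
    exact DFunLike.congr_fun this F
  · rw [hlin, h]
    simp [← hΛ]
  · intro c hc
    rw [hlin, hc, map_zero, zero_add]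
    exact Ideal.sum_mem _ fun j _ =>
      Ideal.mul_mem_left _ _ (Ideal.subset_span (Set.mem_range_self j))

/-- The local ideal at a triple point, of colength at least `6`. -/
lemma exists_local_ideal {c₀ p : Fin 4 → ℂ} (h : c₀ ⬝ᵥ p = 1) {F G H : MvPolynomial (Fin 4) ℂ}
    (hF : MultAtLeast F p 3) (hG : MultAtLeast G p 1) {c : Fin 4 → ℂ}
    (hH : H = ∑ i, c i • pderiv i F) :
    ∃ I : Ideal (MvPolynomial (Fin 4) ℂ), F ∈ I ∧ G ∈ I ∧ H ∈ I ∧ linForm c₀ - 1 ∈ I ∧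
      (∀ c : Fin 4 → ℂ, c ⬝ᵥ p = 0 → linForm c ^ 4 ∈ I) ∧
      FiniteDimensional ℂ (MvPolynomial (Fin 4) ℂ ⧸ I) ∧
      6 ≤ Module.finrank ℂ (MvPolynomial (Fin 4) ℂ ⧸ I) := by
  obtain ⟨φ, hφ, hφ₀, hφm, hφl⟩ := exists_chart h
  have hH2 : φ H ∈ idealOfVars (Fin 3) ℂ ^ 2 := by
    rw [hH, map_sum]
    refine Ideal.sum_mem _ fun i _ => ?_
    rw [map_smul]
    exact Submodule.smul_of_tower_mem _ _ (hφm _ _ (hF.pderiv i))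
  let J := idealOfVars (Fin 3) ℂ ^ 4 ⊔ Ideal.span {φ F, φ G, φ H}
  obtain ⟨hfin, hsix⟩ := six_le_finrank_quotient (hφm _ _ hF) hH2 (hφm _ _ hG) (J := J) rfl
  let π := (Ideal.Quotient.mkₐ ℂ J).comp φ
  have hπ : Function.Surjective π := (Ideal.Quotient.mkₐ_surjective ℂ J).comp hφ
  have hmem : ∀ x, x ∈ RingHom.ker π ↔ φ x ∈ J := fun x => Ideal.Quotient.eq_zero_iff_mem
  have hsub : ∀ x ∈ ({φ F, φ G, φ H} : Set (MvPolynomial (Fin 3) ℂ)), x ∈ J := fun x hx =>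
    Ideal.mem_sup_right (Ideal.subset_span hx)
  let e := Ideal.quotientKerAlgEquivOfSurjective hπ
  refine ⟨RingHom.ker π, (hmem _).2 (hsub _ (by simp)), (hmem _).2 (hsub _ (by simp)),
    (hmem _).2 (hsub _ (by simp)), ?_, fun c hc => ?_, ?_, ?_⟩
  · rw [hmem, map_sub, hφ₀, map_one, sub_self]
    exact zero_mem _
  · rw [hmem, map_pow]
    exact Ideal.mem_sup_left (Ideal.pow_mem_pow (hφl c hc) 4)
  · exact Module.Finite.equiv e.symm.toLinearEquiv
  · rw [e.toLinearEquiv.finrank_eq]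
    exact hsix

end Charts

section Evaluation

variable {σ : Type*} [Fintype σ] {K : Type*} [Field K]

lemma linForm_isHomogeneous (c : σ → K) : (linForm c).IsHomogeneous 1 :=
  IsHomogeneous.sum _ _ _ fun i _ => by
    simpa using (isHomogeneous_C σ (c i)).mul (isHomogeneous_X K i)

lemma linForm_sub (c c' : σ → K) : linForm (c - c') = linForm c - linForm c' := by
  simp [linForm, sub_mul, Finset.sum_sub_distrib]

/-- Homogenization with respect to a linear form that is congruent to `1`. -/
lemma exists_isHomogeneous_sub_mem {c₀ : σ → K} (F : MvPolynomial σ K) {n : ℕ}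
    (hn : F.totalDegree ≤ n) : ∃ G : MvPolynomial σ K, G.IsHomogeneous n ∧
      ∀ I : Ideal (MvPolynomial σ K), linForm c₀ - 1 ∈ I → F - G ∈ I := by
  refine ⟨∑ k ∈ Finset.range (F.totalDegree + 1),
    linForm c₀ ^ (n - k) * homogeneousComponent k F, IsHomogeneous.sum _ _ _ fun k hk => ?_,
    fun I hI => ?_⟩
  · have h1 := ((linForm_isHomogeneous c₀).pow (n - k)).mul
      (homogeneousComponent_isHomogeneous k F)
    rwa [one_mul, Nat.sub_add_cancel (by have := Finset.mem_range.1 hk; omega)] at h1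
  · nth_rw 1 [← sum_homogeneousComponent F]
    rw [← Finset.sum_sub_distrib]
    refine Ideal.sum_mem _ fun k _ => ?_
    rw [← Ideal.Quotient.eq_zero_iff_mem] at hI ⊢
    rw [map_sub, map_one, sub_eq_zero] at hI
    simp [hI]

/-- Forms of large degree with prescribed classes modulo ideals supported at distinct points. -/
lemma exists_finrank_add_sum_finrank_quotient_le {ι : Type*} [Fintype ι] {c₀ : σ → K}
    {I : ι → Ideal (MvPolynomial σ K)} (hI : ∀ i, linForm c₀ - 1 ∈ I i)
    [∀ i, FiniteDimensional K (MvPolynomial σ K ⧸ I i)]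
    (hcop : Pairwise fun i j => IsCoprime (I i) (I j)) :
    ∃ n₀, ∀ n ≥ n₀, ∀ W : Submodule K (MvPolynomial σ K), W ≤ homogeneousSubmodule σ K n →
      (∀ i, ∀ x ∈ W, x ∈ I i) →
      Module.finrank K W + ∑ i, Module.finrank K (MvPolynomial σ K ⧸ I i) ≤
        Module.finrank K (homogeneousSubmodule σ K n) := by
  let q : MvPolynomial σ K →ₗ[K] ((i : ι) → MvPolynomial σ K ⧸ I i) :=
    LinearMap.pi fun i => (Ideal.Quotient.mkₐ K (I i)).toLinearMap
  have hq : Function.Surjective q := fun y => by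
    obtain ⟨x, hx⟩ := Ideal.pi_quotient_surjective hcop y
    exact ⟨x, funext hx⟩
  let b := Module.finBasis K ((i : ι) → MvPolynomial σ K ⧸ I i)
  choose x hx using fun j => hq (b j)
  refine ⟨Finset.univ.sup fun j => (x j).totalDegree, fun n hn W hW hWI => ?_⟩
  let r := q ∘ₗ (homogeneousSubmodule σ K n).subtype
  have hr : LinearMap.range r = ⊤ := by
    rw [eq_top_iff, ← b.span_eq, Submodule.span_le]
    rintro _ ⟨j, rfl⟩
    obtain ⟨G, hG, hGI⟩ := exists_isHomogeneous_sub_mem (c₀ := c₀) (x j)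
      ((Finset.le_sup (f := fun j => (x j).totalDegree) (Finset.mem_univ j)).trans hn)
    refine ⟨⟨G, hG⟩, ?_⟩
    rw [← hx j]
    funext i
    exact (Ideal.Quotient.eq.2 (hGI _ (hI i))).symm
  have hker : Module.finrank K W ≤ Module.finrank K (LinearMap.ker r) := by
    refine LinearMap.finrank_le_finrank_of_injective
      (f := (Submodule.inclusion hW).codRestrict (LinearMap.ker r) fun w => ?_) ?_
    · rw [LinearMap.mem_ker]
      funext i
      exact Ideal.Quotient.eq_zero_iff_mem.2 (hWI i w w.2)
    · intro w w' hww
      exact Submodule.inclusion_injective hW (congrArg Subtype.val hww)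
  have hrn := r.finrank_range_add_finrank_ker
  rw [hr, finrank_top, Module.finrank_pi_fintype] at hrn
  omega

/-- Ideals supported at distinct points are coprime. -/
lemma isCoprime_of_pow_linForm_mem {c₀ c : σ → K} {I J : Ideal (MvPolynomial σ K)} {m : ℕ}
    (hJ : linForm c₀ - 1 ∈ J) (hcI : linForm c ^ m ∈ I) (hcJ : linForm (c₀ - c) ^ m ∈ J) :
    IsCoprime I J := by
  have h1 : (1 - linForm c) ^ m ∈ J := by
    rw [← Ideal.Quotient.eq_zero_iff_mem] at hJ hcJ ⊢
    rw [map_sub, sub_eq_zero, map_one] at hJ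
    rwa [linForm_sub, map_pow, map_sub, hJ, ← map_one (Ideal.Quotient.mk J), ← map_sub,
      ← map_pow] at hcJ
  have h2 : IsCoprime (linForm c) (1 - linForm c) := ⟨1, 1, by ring⟩
  obtain ⟨a, b, hab⟩ := h2.pow (m := m) (n := m)
  refine Ideal.isCoprime_iff_exists.2
    ⟨_, Ideal.mul_mem_left _ a hcI, _, Ideal.mul_mem_left _ b h1, hab⟩

/-- Finitely many nonzero vectors avoid a common hyperplane. -/
lemma exists_dotProduct_ne_zero [Infinite K] {ι : Type*} [Finite ι] {p : ι → σ → K}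
    (hp : ∀ i, p i ≠ 0) : ∃ c : σ → K, ∀ i, c ⬝ᵥ p i ≠ 0 := by
  by_contra! hcon
  let V : ι → Subspace K (σ → K) := fun i => LinearMap.ker ((dotProductBilin K K).flip (p i))
  obtain ⟨i, hi⟩ := Subspace.exists_eq_top_of_iUnion_eq_univ (p := V) (by
    refine Set.eq_univ_of_forall fun c => ?_
    obtain ⟨i, hi⟩ := hcon c
    exact Set.mem_iUnion.2 ⟨i, hi⟩)
  refine hp i (dotProduct_eq_zero _ fun w => ?_)
  rw [dotProduct_comm]
  exact LinearMap.mem_ker.1 (hi ▸ Submodule.mem_top : w ∈ V i)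

/-- A linear form separating two points of an affine hyperplane. -/
lemma exists_dotProduct_eq_zero_eq_one {c₀ p q : σ → K} (hp : c₀ ⬝ᵥ p = 1) (hq : c₀ ⬝ᵥ q = 1)
    (hpq : p ≠ q) : ∃ c : σ → K, c ⬝ᵥ p = 0 ∧ c ⬝ᵥ q = 1 := by
  classical
  obtain ⟨j, hj⟩ := Function.ne_iff.1 hpq
  have hne : q j - p j ≠ 0 := sub_ne_zero.2 (Ne.symm hj)
  refine ⟨(q j - p j)⁻¹ • (Pi.single j 1 - p j • c₀), ?_, ?_⟩
  · simp [sub_dotProduct, hp]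
  · simp [sub_dotProduct, hq, hne]

end Evaluation

section ProjectivePoints

lemma eval_smul_of_isHomogeneous {σ K : Type*} [Fintype σ] [CommRing K] {F : MvPolynomial σ K}
    {k : ℕ} (hF : F.IsHomogeneous k) (t : K) (v : σ → K) :
    eval (t • v) F = t ^ k * eval v F := by
  rw [eval_eq', eval_eq', Finset.mul_sum]
  refine Finset.sum_congr rfl fun m hm => ?_
  have hdeg := hF (mem_support_iff.1 hm)
  rw [Finsupp.weight_apply, Finsupp.sum_fintype _ _ (by simp)] at hdeg
  simp only [Pi.one_apply, smul_eq_mul, mul_one] at hdeg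
  simp only [Pi.smul_apply, smul_eq_mul, mul_pow, Finset.prod_mul_distrib,
    Finset.prod_pow_eq_pow_sum, hdeg]
  ring

lemma exists_isHomogeneous_pderivList {n k : ℕ} {F : MvPolynomial (Fin n) ℂ}
    (hF : F.IsHomogeneous k) (l : List (Fin n)) : ∃ k', (pderivList l F).IsHomogeneous k' := by
  induction l generalizing F k with
  | nil => exact ⟨k, hF⟩
  | cons i l ih => exact ih hF.pderiv

lemma MultAtLeast.smul {n k m : ℕ} {F : MvPolynomial (Fin n) ℂ} (hF : F.IsHomogeneous k)
    {p : Fin n → ℂ} (h : MultAtLeast F p m) (t : ℂ) : MultAtLeast F (t • p) m := by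
  intro l hl
  obtain ⟨k', hk'⟩ := exists_isHomogeneous_pderivList hF l
  rw [eval_smul_of_isHomogeneous hk', h l hl, mul_zero]

lemma singularAt_of_eval_pderiv_eq_zero {f : MvPolynomial (Fin 4) ℂ} {d : ℕ} (hd : d ≠ 0)
    (hf : f.IsHomogeneous d) {v : Fin 4 → ℂ} (hv : ∀ i, eval v (pderiv i f) = 0) :
    SingularAt f v := by
  have h0 : eval v f = 0 := by
    have := congrArg (eval v) hf.sum_X_mul_pderiv
    rw [map_sum, nsmul_eq_mul, map_mul, Finset.sum_eq_zero fun i _ => by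
      rw [map_mul, hv, mul_zero]] at this
    simpa [hd] using this
  rintro (_ | ⟨i, _ | ⟨j, l⟩⟩) hl
  · exact h0
  · exact hv i
  · simp at hl

end ProjectivePoints

/-- the polar bound.  If a degree-`d` surface (`d ≥ 5`) has only `ν` ordinary
triple points as singularities and some nonzero form of degree `d − 4` vanishes at all of
them, then `ν ≤ d(d−1)(d−4)/6`. -/
theorem polar_bound
    (d ν : ℕ) (hd : 5 ≤ d)
    (f : MvPolynomial (Fin 4) ℂ) (hf : f ≠ 0) (hhom : f.IsHomogeneous d)
    (hX : OnlyTriplePoints d ν f)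
    (hadj : ∃ g : MvPolynomial (Fin 4) ℂ, g ≠ 0 ∧ g.IsHomogeneous (d - 4) ∧
      ∀ P ∈ SingSet f, MvPolynomial.eval P.rep g = 0) :
    6 * ν ≤ d * (d - 1) * (d - 4) := by
  classical
  obtain ⟨hfin, hcard, htriple⟩ := hX
  obtain ⟨g, hg0, hg, hgz⟩ := hadj
  obtain hempty | ⟨P₀, hP₀⟩ := (SingSet f).eq_empty_or_nonempty
  · rw [← hcard, hempty, Set.ncard_empty]
    exact Nat.zero_le _
  have hT0 : ∀ v ∈ hfin.toFinset.image Projectivization.rep, v ≠ 0 := by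
    intro v hv
    obtain ⟨P, -, rfl⟩ := Finset.mem_image.1 hv
    exact P.rep_nonzero
  have hT : ∀ v, (∀ i, eval v (pderiv i f) = 0) →
      ∃ P ∈ hfin.toFinset.image Projectivization.rep, ∃ t : ℂ, v = t • P := by
    intro v hv
    by_cases hv0 : v = 0
    · exact ⟨P₀.rep, Finset.mem_image_of_mem _ (hfin.mem_toFinset.2 hP₀), 0, by simp [hv0]⟩
    · obtain ⟨a, ha⟩ := Projectivization.exists_smul_eq_mk_rep ℂ v hv0
      refine ⟨_, Finset.mem_image_of_mem _
        ((hfin.mem_toFinset (a := Projectivization.mk ℂ v hv0)).2 ?_),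
        (a⁻¹ : ℂˣ), ?_⟩
      · change SingularAt f _
        rw [← ha]
        exact (singularAt_of_eval_pderiv_eq_zero (by omega) hhom hv).smul hhom (a : ℂ)
      · rw [← ha]
        exact (inv_smul_smul a v).symm
  have hrel : IsRelPrime f g := isRelPrime_of_totalDegree_lt hT0 hT hf hhom hg0 (by
    rw [hg.totalDegree hg0]
    omega)
  obtain ⟨c, hc⟩ := exists_polar_regular hT0 hT hrel hg0
  set h : MvPolynomial (Fin 4) ℂ := ∑ i, c i • pderiv i f with hh
  have hhhom : h.IsHomogeneous (d - 1) := IsHomogeneous.sum _ _ _ fun i _ => by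
    rw [smul_eq_C_mul]
    simpa using (isHomogeneous_C _ (c i)).mul hhom.pderiv
  have hh0 : h ≠ 0 := by
    intro h0
    have h1 := hc 1 (by simp [h0])
    obtain ⟨a, b, hab⟩ := Ideal.mem_span_pair.1 h1
    have hf0 : eval P₀.rep f = 0 := (htriple P₀ hP₀).1.eval_eq_zero
    have := congrArg (eval P₀.rep) hab
    rw [map_add, map_mul, map_mul, hf0, hgz P₀ hP₀] at this
    simp at this
  have : Fintype (SingSet f) := hfin.fintype
  obtain ⟨c₀, hc₀⟩ := exists_dotProduct_ne_zero (p := fun P : SingSet f => P.1.rep)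
    fun P => P.1.rep_nonzero
  let p : SingSet f → Fin 4 → ℂ := fun P => (c₀ ⬝ᵥ P.1.rep)⁻¹ • P.1.rep
  have hp : ∀ P, c₀ ⬝ᵥ p P = 1 := fun P => by
    rw [dotProduct_smul, smul_eq_mul, inv_mul_cancel₀ (hc₀ P)]
  have hpinj : Function.Injective p := by
    intro P Q hPQ
    have hne := inv_ne_zero (hc₀ P)
    apply Subtype.ext
    rw [← P.1.mk_rep, ← Q.1.mk_rep, Projectivization.mk_eq_mk_iff']
    refine ⟨(c₀ ⬝ᵥ P.1.rep) * (c₀ ⬝ᵥ Q.1.rep)⁻¹, ?_⟩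
    rw [mul_smul]
    change _ • p Q = _
    rw [← hPQ]
    exact smul_inv_smul₀ (hc₀ P) _
  choose I hIf hIg hIh hI1 hI4 hIfin hI6 using fun P : SingSet f =>
    exists_local_ideal (hp P) (F := f) (G := g) (H := h)
      ((htriple P.1 P.2).1.smul hhom _)
      (MultAtLeast.smul hg (m := 1) (fun l hl => by
        rw [List.length_eq_zero_iff.1 (Nat.lt_one_iff.1 hl)]
        exact hgz P.1 P.2) _) hh
  have hcop : Pairwise fun P Q => IsCoprime (I P) (I Q) := by
    intro P Q hPQ
    obtain ⟨e, heP, heQ⟩ := exists_dotProduct_eq_zero_eq_one (hp P) (hp Q) (hpinj.ne hPQ)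
    exact isCoprime_of_pow_linForm_mem (hI1 Q) (hI4 P e heP)
      (hI4 Q _ (by rw [sub_dotProduct, hp, heQ, sub_self]))
  obtain ⟨n, hn⟩ := exists_finrank_add_sum_finrank_quotient_le hI1 hcop
  have hle := hn (n + d + (d - 4) + (d - 1)) (by omega)
    (gradedPiece (Ideal.span {f} ⊔ Ideal.span {g} ⊔ Ideal.span {h}) _) inf_le_right
    fun P x hx => by
      refine SetLike.le_def.1 (sup_le (sup_le ?_ ?_) ?_) (mem_gradedPiece.1 hx).1 <;>
      simpa [Ideal.span_le] using by first | exact hIf P | exact hIg P | exact hIh P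
  have hbez := finrank_gradedPiece_complete_intersection hhom hg hhhom hf hg0 hh0
    (fun y hy => hrel.dvd_of_dvd_mul_left hy)
    (fun y hy => by
      rw [← Ideal.span_union] at hy ⊢
      exact hc y hy) n
  have hsum : 6 * ν ≤ ∑ P, Module.finrank ℂ (MvPolynomial (Fin 4) ℂ ⧸ I P) := by
    refine le_trans (le_of_eq ?_) (Finset.card_nsmul_le_sum _ _ 6 fun P _ => hI6 P)
    rw [Finset.card_univ, smul_eq_mul, ← Nat.card_eq_fintype_card, ← hcard, mul_comm]
    rfl
  have hcomm : d * (d - 4) * (d - 1) = d * (d - 1) * (d - 4) := by ring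
  omega
end
end

section
/- Let P₁, …, P₅ be five points of ℙ²(ℂ), no three of which are collinear, and let q be a nonzero quadratic form in ℂ[x₀,x₁,x₂] vanishing at all five points. If g ∈ ℂ[x₀,x₁,x₂] is a nonzero homogeneous polynomial of degree 6 having multiplicity ≥ 3 at each Pᵢ (all partial derivatives of g of order ≤ 2 vanish at representatives of the Pᵢ), then g = λ q³ for some λ ∈ ℂ∖{0}. -/
open MvPolynomial

noncomputable section

theorem sum_eq_of_mem_support {σ R : Type*} [Fintype σ] [CommSemiring R] {f : MvPolynomial σ R}
    {n : ℕ} (hf : f.IsHomogeneous n) {d : σ →₀ ℕ} (hd : d ∈ f.support) : ∑ i, d i = n := by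
  rw [hf.degree_eq_sum_deg_support hd]
  exact (Finset.sum_subset (Finset.subset_univ _) (by simp)).symm

/-- A homogeneous polynomial of degree `n` scales by the `n`-th power. -/
theorem aeval_smul_of_isHomogeneous {σ R A : Type*} [Fintype σ] [CommRing R] [CommRing A]
    [Algebra R A] {f : MvPolynomial σ R} {n : ℕ} (hf : f.IsHomogeneous n) (c : A) (x : σ → A) :
    aeval (fun i => c * x i) f = c ^ n * aeval x f := by
  simp only [aeval_def, eval₂_eq', Finset.mul_sum]
  refine Finset.sum_congr rfl fun d hd => ?_
  simp only [mul_pow, Finset.prod_mul_distrib, Finset.prod_pow_eq_pow_sum,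
    sum_eq_of_mem_support hf hd]
  ring

theorem eval_smul_of_isHomogeneous_s9 {f : MvPolynomial (Fin 3) ℂ} {n : ℕ} (hf : f.IsHomogeneous n)
    (c : ℂ) (x : Fin 3 → ℂ) : eval (c • x) f = c ^ n * eval x f := by
  have h := aeval_smul_of_isHomogeneous hf c x
  exact h

/-- The top coefficient of a form of degree `n` restricted to a curve of degree `≤ m`. -/
theorem coeff_aeval_of_natDegree_le {σ R : Type*} [Fintype σ] [CommRing R]
    {f : MvPolynomial σ R} {n m : ℕ} (hf : f.IsHomogeneous n) (γ : σ → Polynomial R)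
    (hγ : ∀ i, (γ i).natDegree ≤ m) :
    (aeval γ f).natDegree ≤ n * m ∧
      (aeval γ f).coeff (n * m) = eval (fun i => (γ i).coeff m) f := by
  have key : ∀ (d : σ → ℕ) (s : Finset σ),
      (∏ i ∈ s, γ i ^ d i).natDegree ≤ (∑ i ∈ s, d i) * m ∧
      (∏ i ∈ s, γ i ^ d i).coeff ((∑ i ∈ s, d i) * m) = ∏ i ∈ s, (γ i).coeff m ^ d i := by
    classical
    intro d s
    induction s using Finset.induction_on with
    | empty => simp
    | insert a s ha ih =>
      have h1 : (γ a ^ d a).natDegree ≤ d a * m := Polynomial.natDegree_pow_le_of_le _ (hγ a)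
      rw [Finset.prod_insert ha, Finset.prod_insert ha, Finset.sum_insert ha, add_mul]
      refine ⟨Polynomial.natDegree_mul_le_of_le h1 ih.1, ?_⟩
      rw [Polynomial.coeff_mul_add_eq_of_natDegree_le h1 ih.1, ih.2,
        Polynomial.coeff_pow_of_natDegree_le (hγ a)]
  simp only [aeval_def, eval₂_eq', eval_eq', Polynomial.algebraMap_eq]
  constructor
  · refine Polynomial.natDegree_sum_le_of_forall_le _ _ fun d h => ?_
    refine (Polynomial.natDegree_C_mul_le _ _).trans ?_
    have := (key d Finset.univ).1
    rwa [sum_eq_of_mem_support hf h] at this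
  · rw [Polynomial.finsetSum_coeff]
    refine Finset.sum_congr rfl fun d h => ?_
    have := (key d Finset.univ).2
    rw [sum_eq_of_mem_support hf h] at this
    rw [Polynomial.coeff_C_mul, this]

/-- A cofactor of a form in a form is again a form. -/
theorem isHomogeneous_of_mul {σ R : Type*} [CommRing R] [IsDomain R]
    {f g : MvPolynomial σ R} {m n : ℕ} (hf : f ≠ 0) (hfm : f.IsHomogeneous m)
    (hfg : (f * g).IsHomogeneous (m + n)) : g.IsHomogeneous n := by
  have h : f * g = f * homogeneousComponent n g := by
    conv_lhs => rw [← homogeneousComponent_eq_self hfg, ← sum_homogeneousComponent g, Finset.mul_sum,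
      map_sum]
    have : ∀ i, homogeneousComponent (m + n) (f * homogeneousComponent i g) =
        if i = n then f * homogeneousComponent n g else 0 := fun i => by
      rw [homogeneousComponent_of_mem (hfm.mul (homogeneousComponent_isHomogeneous i g))]
      by_cases hi : i = n
      · simp [hi]
      · rw [if_neg (by omega), if_neg hi]
    simp only [this, Finset.sum_ite_eq', Finset.mem_range]
    split_ifs with hn
    · rfl
    · rw [homogeneousComponent_eq_zero _ _ (by omega), mul_zero]
  rw [mul_left_cancel₀ hf h]
  exact homogeneousComponent_isHomogeneous n g

/-- The generic expansion `f ↦ f (p + T y)` at `p`, where `y` are the variables. -/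
def expandAt (p : Fin 3 → ℂ) :
    MvPolynomial (Fin 3) ℂ →ₐ[ℂ] Polynomial (MvPolynomial (Fin 3) ℂ) :=
  aeval fun i => Polynomial.C (C (p i)) + Polynomial.X * Polynomial.C (X i)

theorem coeff_zero_expandAt (p : Fin 3 → ℂ) (f : MvPolynomial (Fin 3) ℂ) :
    (expandAt p f).coeff 0 = C (eval p f) := by
  induction f using MvPolynomial.induction_on with
  | C a => simp [expandAt, Polynomial.algebraMap_apply]
  | add f g hf hg => simp [hf, hg]
  | mul_X f i hf =>
    rw [map_mul, Polynomial.mul_coeff_zero, hf]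
    simp [expandAt]

theorem derivative_expandAt (p : Fin 3 → ℂ) (f : MvPolynomial (Fin 3) ℂ) :
    Polynomial.derivative (expandAt p f) =
      ∑ i, Polynomial.C (X i) * expandAt p (pderiv i f) := by
  induction f using MvPolynomial.induction_on with
  | C a => simp [expandAt, Polynomial.algebraMap_apply]
  | add f g hf hg => simp [hf, hg, mul_add, Finset.sum_add_distrib]
  | mul_X f j hf =>
    have hj : Polynomial.derivative (expandAt p (X j)) = Polynomial.C (X j) := by
      simp [expandAt]
    simp only [map_mul, Polynomial.derivative_mul, hf, hj, pderiv_mul, map_add, mul_add,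
      Finset.sum_add_distrib, pderiv_X, Pi.single_apply, Finset.sum_mul]
    refine congrArg₂ (· + ·) (Finset.sum_congr rfl fun i _ => mul_assoc _ _ _) ?_
    rw [Finset.sum_eq_single j (fun i _ hi => by simp [hi.symm]) (by simp)]
    simp [mul_comm]

/-- If a derivative is divisible by `T ^ m` and the constant term vanishes then `T ^ (m + 1)`
divides. -/
theorem X_pow_succ_dvd_of_derivative {A : Type*} [CommRing A] [IsDomain A] [CharZero A]
    {F : Polynomial A} {m : ℕ} (h0 : F.coeff 0 = 0)
    (hd : Polynomial.X ^ m ∣ Polynomial.derivative F) : Polynomial.X ^ (m + 1) ∣ F := by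
  rw [Polynomial.X_pow_dvd_iff] at hd ⊢
  rintro (_ | d) hdm
  · exact h0
  · have := hd d (by omega)
    rw [Polynomial.coeff_derivative] at this
    exact (mul_eq_zero.mp this).resolve_right (by exact_mod_cast d.succ_ne_zero)

theorem MultAtLeast.X_pow_dvd_expandAt {p : Fin 3 → ℂ} {m : ℕ} {f : MvPolynomial (Fin 3) ℂ}
    (h : MultAtLeast f p m) : Polynomial.X ^ m ∣ expandAt p f := by
  induction m generalizing f with
  | zero => simp
  | succ m ih =>
    refine X_pow_succ_dvd_of_derivative ?_ ?_
    · rw [coeff_zero_expandAt]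
      simpa [pderivList] using h [] (by simp)
    · rw [derivative_expandAt]
      refine Finset.dvd_sum fun i _ => Dvd.dvd.mul_left (ih fun l hl => ?_) _
      simpa [pderivList] using h (i :: l) (by simpa using hl)

/-- Order of contact of a curve through `p` with a hypersurface of multiplicity `≥ k` at `p`. -/
theorem X_sub_C_pow_dvd_aeval {p : Fin 3 → ℂ} {k n : ℕ} {f : MvPolynomial (Fin 3) ℂ}
    (hf : f.IsHomogeneous n) (h : Polynomial.X ^ k ∣ expandAt p f) {γ : Fin 3 → Polynomial ℂ}
    {t c : ℂ} (hc : c ≠ 0) (hγ : ∀ j, (γ j).eval t = c * p j) :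
    (Polynomial.X - Polynomial.C t) ^ k ∣ aeval γ f := by
  have hdvd : ∀ j, ∃ d, γ j = Polynomial.C c *
      (Polynomial.C (p j) + (Polynomial.X - Polynomial.C t) * d) := fun j => by
    have : (Polynomial.X - Polynomial.C t) ∣ γ j - Polynomial.C (c * p j) := by
      rw [Polynomial.dvd_iff_isRoot]; simp [hγ]
    obtain ⟨d, hd⟩ := this
    refine ⟨Polynomial.C c⁻¹ * d, ?_⟩
    have hcc : Polynomial.C c * Polynomial.C c⁻¹ = 1 := by
      rw [← Polynomial.C_mul, mul_inv_cancel₀ hc, Polynomial.C_1]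
    rw [Polynomial.C_mul] at hd
    linear_combination hd - (Polynomial.X - Polynomial.C t) * d * hcc
  choose d hd using hdvd
  rw [show γ = _ from funext hd, aeval_smul_of_isHomogeneous hf]
  refine Dvd.dvd.mul_left ?_ _
  let ψ : Polynomial (MvPolynomial (Fin 3) ℂ) →+* Polynomial ℂ :=
    Polynomial.eval₂RingHom (aeval d).toRingHom (Polynomial.X - Polynomial.C t)
  have hψ : ∀ f, ψ (expandAt p f) =
      aeval (fun j => Polynomial.C (p j) + (Polynomial.X - Polynomial.C t) * d j) f := by
    intro f
    induction f using MvPolynomial.induction_on with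
    | C a => simp [ψ, expandAt, Polynomial.algebraMap_apply]
    | add f g hf hg => simp only [map_add, hf, hg]
    | mul_X f i hf =>
      simp only [map_mul, hf]
      simp [ψ, expandAt, mul_comm (d i)]
  rw [← hψ]
  simpa [ψ] using map_dvd ψ h

theorem exists_linear_of_isHomogeneous_one {f : MvPolynomial (Fin 3) ℂ} (hf : f.IsHomogeneous 1) :
    ∃ l : (Fin 3 → ℂ) →ₗ[ℂ] ℂ, ∀ u, eval u f = l u := by
  have hc : ∀ i, ∃ a, pderiv i f = C a := fun i =>
    ⟨_, totalDegree_eq_zero_iff_eq_C.mp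
      ((totalDegree_zero_iff_isHomogeneous _).mpr (hf.pderiv (i := i)))⟩
  choose a ha using hc
  refine ⟨∑ i, a i • LinearMap.proj i, fun u => ?_⟩
  have h := congrArg (eval u) hf.sum_X_mul_pderiv
  simp only [ha, map_sum, map_mul, eval_X, eval_C, one_smul] at h
  simp [← h, mul_comm]

theorem exists_symm_bilin_of_isHomogeneous_two {q : MvPolynomial (Fin 3) ℂ}
    (hq : q.IsHomogeneous 2) :
    ∃ B : LinearMap.BilinForm ℂ (Fin 3 → ℂ), (∀ u v, B u v = B v u) ∧ ∀ u, eval u q = B u u := by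
  choose l hl using fun i => exists_linear_of_isHomogeneous_one (hq.pderiv (i := i))
  let B₀ : LinearMap.BilinForm ℂ (Fin 3 → ℂ) := ∑ i, (LinearMap.proj i).smulRight (l i)
  refine ⟨(1 / 4 : ℂ) • (B₀ + B₀.flip), fun u v => ?_, fun u => ?_⟩
  · simp [add_comm]
  · have h := congrArg (eval u) hq.sum_X_mul_pderiv
    simp only [hl, map_sum, map_mul, eval_X, nsmul_eq_mul, map_natCast] at h
    have hB : B₀ u u = 2 * eval u q := by simpa [B₀] using h
    have hB' : B₀.flip u u = 2 * eval u q := hB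
    simp only [LinearMap.smul_apply, LinearMap.add_apply, hB, hB', smul_eq_mul]
    ring

/-- A polynomial of degree `≤ 1` is affine linear. -/
theorem exists_affine_of_totalDegree_le_one {f : MvPolynomial (Fin 3) ℂ} (hf : f.totalDegree ≤ 1) :
    ∃ (a : ℂ) (l : (Fin 3 → ℂ) →ₗ[ℂ] ℂ), ∀ u, eval u f = a + l u := by
  obtain ⟨l, hl⟩ := exists_linear_of_isHomogeneous_one (homogeneousComponent_isHomogeneous 1 f)
  refine ⟨coeff 0 f, l, fun u => ?_⟩
  have hs : f = homogeneousComponent 0 f + homogeneousComponent 1 f := by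
    conv_lhs => rw [← sum_homogeneousComponent f]
    interval_cases h : f.totalDegree
    · simp [homogeneousComponent_eq_zero 1 f (by omega)]
    · simp [Finset.sum_range_succ]
  conv_lhs => rw [hs]
  simp [hl]

/-- Two planes cannot cover five points in general position. -/
theorem linear_eq_zero_or_of_mul_eq_zero {p : Fin 5 → Fin 3 → ℂ}
    (hcol : ∀ i j k : Fin 5, i ≠ j → i ≠ k → j ≠ k → LinearIndependent ℂ ![p i, p j, p k])
    (l m : (Fin 3 → ℂ) →ₗ[ℂ] ℂ) (h : ∀ i, l (p i) * m (p i) = 0) : l = 0 ∨ m = 0 := by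
  have hpig : ∀ b : Fin 5 → Bool, ∃ i j k, i ≠ j ∧ i ≠ k ∧ j ≠ k ∧ b i = b j ∧ b j = b k := by
    decide
  have hzero : ∀ (n : (Fin 3 → ℂ) →ₗ[ℂ] ℂ) (i j k : Fin 5), i ≠ j → i ≠ k → j ≠ k →
      n (p i) = 0 → n (p j) = 0 → n (p k) = 0 → n = 0 := by
    intro n i j k hij hik hjk hi hj hk
    refine (basisOfLinearIndependentOfCardEqFinrank (hcol i j k hij hik hjk) (by simp)).ext ?_
    intro s
    fin_cases s <;> simp [hi, hj, hk]
  classical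
  obtain ⟨i, j, k, hij, hik, hjk, h1, h2⟩ := hpig fun i => decide (l (p i) = 0)
  simp only [decide_eq_decide] at h1 h2
  by_cases hi : l (p i) = 0
  · exact .inl (hzero l i j k hij hik hjk hi (h1.mp hi) (h2.mp (h1.mp hi)))
  · have hj := mt h1.mpr hi
    have hk := mt h2.mpr hj
    exact .inr (hzero m i j k hij hik hjk ((mul_eq_zero.mp (h i)).resolve_left hi)
      ((mul_eq_zero.mp (h j)).resolve_left hj) ((mul_eq_zero.mp (h k)).resolve_left hk))

/-- A conic through five points in general position contains no line. -/
theorem bilin_ne_zero_of_linearIndependent {p : Fin 5 → Fin 3 → ℂ}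
    (hcol : ∀ i j k : Fin 5, i ≠ j → i ≠ k → j ≠ k → LinearIndependent ℂ ![p i, p j, p k])
    {B : LinearMap.BilinForm ℂ (Fin 3 → ℂ)} (hB : ∀ u v, B u v = B v u)
    (hp : ∀ i, B (p i) (p i) = 0) (hB0 : ∃ u, B u u ≠ 0) {u v : Fin 3 → ℂ}
    (huv : LinearIndependent ℂ ![u, v]) (hu : B u u = 0) (hv : B v v = 0) : B u v ≠ 0 := by
  intro h
  obtain ⟨w, hw⟩ : ∃ w, w ∉ Submodule.span ℂ (Set.range ![u, v]) := by
    by_contra! hall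
    have h1 := finrank_range_le_card (R := ℂ) ![u, v]
    rw [Set.finrank, (Submodule.eq_top_iff').mpr hall] at h1
    simp at h1
  let b := basisOfLinearIndependentOfCardEqFinrank
    (linearIndependent_finCons.mpr ⟨huv, hw⟩ : LinearIndependent ℂ ![w, u, v]) (by simp)
  have key : ∀ x, B x x = b.coord 0 x *
      (B w w • b.coord 0 + (2 * B w u) • b.coord 1 + (2 * B w v) • b.coord 2) x := by
    intro x
    have hx : x = b.coord 0 x • w + b.coord 1 x • u + b.coord 2 x • v := by
      conv_lhs => rw [← b.sum_repr x]
      simp [Fin.sum_univ_three, b]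
    conv_lhs => rw [hx]
    simp only [map_add, map_smul, LinearMap.add_apply, LinearMap.smul_apply, smul_eq_mul, hu, hv, h,
      hB u w, hB v w, hB v u]
    ring
  obtain h0 | h0 := linear_eq_zero_or_of_mul_eq_zero hcol _ _ fun i => (key (p i)).symm.trans (hp i)
  · have := LinearMap.congr_fun h0 (b 0)
    simp at this
  · obtain ⟨x, hx⟩ := hB0
    exact hx (by rw [key, h0]; simp)

theorem linearIndependent_pair_of_triple {p : Fin 5 → Fin 3 → ℂ}
    (hcol : ∀ i j k : Fin 5, i ≠ j → i ≠ k → j ≠ k → LinearIndependent ℂ ![p i, p j, p k])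
    {i j : Fin 5} (hij : i ≠ j) : LinearIndependent ℂ ![p i, p j] := by
  obtain ⟨k, hik, hjk⟩ : ∃ k, i ≠ k ∧ j ≠ k := by revert i j; decide
  convert! (hcol i j k hij hik hjk).comp Fin.castSucc (Fin.castSucc_injective 2) using 1
  ext s
  fin_cases s <;> rfl

theorem irreducible_conic {p : Fin 5 → Fin 3 → ℂ}
    (hcol : ∀ i j k : Fin 5, i ≠ j → i ≠ k → j ≠ k → LinearIndependent ℂ ![p i, p j, p k])
    {q : MvPolynomial (Fin 3) ℂ} (hq : q ≠ 0) (hq2 : q.IsHomogeneous 2)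
    (hqv : ∀ i, eval (p i) q = 0) : Irreducible q := by
  have hunit : ∀ f : MvPolynomial (Fin 3) ℂ, f ≠ 0 → f.totalDegree = 0 → IsUnit f := by
    intro f hf h
    rw [totalDegree_eq_zero_iff_eq_C] at h
    rw [h] at hf ⊢
    exact (Ne.isUnit fun h0 => hf (by rw [h0, C_0])).map C
  refine ⟨fun hu => ?_, fun a b hab => ?_⟩
  · exact (hu.map (eval (p 0))).ne_zero (hqv 0)
  have ha : a ≠ 0 := by rintro rfl; simp [hq] at hab
  have hb : b ≠ 0 := by rintro rfl; simp [hq] at hab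
  have hdeg : a.totalDegree + b.totalDegree = 2 := by
    rw [← totalDegree_mul_of_isDomain ha hb, ← hab, hq2.totalDegree hq]
  by_cases ha0 : a.totalDegree = 0
  · exact .inl (hunit a ha ha0)
  by_cases hb0 : b.totalDegree = 0
  · exact .inr (hunit b hb hb0)
  exfalso
  obtain ⟨x, l, hl⟩ := exists_affine_of_totalDegree_le_one (show a.totalDegree ≤ 1 by omega)
  obtain ⟨y, m, hm⟩ := exists_affine_of_totalDegree_le_one (show b.totalDegree ≤ 1 by omega)
  have hlm : ∀ v, eval v q = l v * m v := by
    intro v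
    have hs : ∀ c : ℂ, c ^ 2 * eval v q = (x + c * l v) * (y + c * m v) := fun c => by
      rw [← eval_smul_of_isHomogeneous_s9 hq2, hab, map_mul, hl, hm]
      simp
    linear_combination (1 / 2) * hs 1 + (1 / 2) * hs (-1) - hs 0
  refine hq (MvPolynomial.funext fun v => ?_)
  rw [hlm, map_zero]
  obtain h | h := linear_eq_zero_or_of_mul_eq_zero hcol l m fun i => by rw [← hlm, hqv]
  · simp [h]
  · simp [h]

theorem polynomial_eval_aeval {σ R : Type*} [CommRing R] (γ : σ → Polynomial R)
    (f : MvPolynomial σ R) (t : R) :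
    (aeval γ f).eval t = eval (fun j => (γ j).eval t) f := by
  induction f using MvPolynomial.induction_on with
  | C a => simp
  | add f g hf hg => simp [hf, hg]
  | mul_X f i hf => simp [hf]

theorem not_X_sq_dvd_expandAt {q : MvPolynomial (Fin 3) ℂ} (hq2 : q.IsHomogeneous 2)
    {B : LinearMap.BilinForm ℂ (Fin 3 → ℂ)} (hB : ∀ u v, B u v = B v u)
    (hBq : ∀ u, eval u q = B u u) {u v : Fin 3 → ℂ} (hu : B u u = 0) (hv : B v v = 0)
    (huv : B u v ≠ 0) : ¬ Polynomial.X ^ 2 ∣ expandAt u q := by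
  intro h
  let γ : Fin 3 → Polynomial ℂ := fun j => Polynomial.C (u j) + Polynomial.X * Polynomial.C (v j)
  have h1 := X_sub_C_pow_dvd_aeval hq2 h (γ := γ) (t := 0) one_ne_zero (by simp [γ])
  have h2 : aeval γ q = Polynomial.C (2 * B u v) * Polynomial.X := by
    refine Polynomial.funext fun t => ?_
    have : (fun j => (γ j).eval t) = u + t • v := by ext j; simp [γ, mul_comm t]
    rw [polynomial_eval_aeval, this, hBq]
    simp [hu, hv, hB v u]
    ring
  rw [h2, Polynomial.C_0, sub_zero, Polynomial.X_pow_dvd_iff] at h1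
  have := h1 1 one_lt_two
  simp [huv] at this

/-- A form of degree `2k` having contact of order `≥ k` at five distinct parameters with a curve of
degree `≤ 2` vanishes at the point at infinity of the curve. -/
theorem eval_coeff_two_eq_zero {k : ℕ} (hk : 0 < k) {f : MvPolynomial (Fin 3) ℂ}
    (hf : f.IsHomogeneous (2 * k)) {γ : Fin 3 → Polynomial ℂ} (hγ : ∀ j, (γ j).natDegree ≤ 2)
    {t : Fin 5 → ℂ} (ht : Function.Injective t)
    (hdvd : ∀ i, (Polynomial.X - Polynomial.C (t i)) ^ k ∣ aeval γ f) :
    eval (fun j => (γ j).coeff 2) f = 0 := by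
  obtain ⟨hdeg, hcoeff⟩ := coeff_aeval_of_natDegree_le hf γ hγ
  have hprod : ∏ i, (Polynomial.X - Polynomial.C (t i)) ^ k ∣ aeval γ f :=
    Finset.prod_dvd_of_coprime
      (fun i _ j _ hij => (Polynomial.pairwise_coprime_X_sub_C ht hij).pow) fun i _ => hdvd i
  have hzero : aeval γ f = 0 := by
    refine Polynomial.eq_zero_of_dvd_of_natDegree_lt hprod ?_
    rw [Polynomial.natDegree_prod_of_monic _ _ fun i _ => (Polynomial.monic_X_sub_C _).pow k]
    simp
    omega
  rw [← hcoeff, hzero, Polynomial.coeff_zero]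

/-- Parametrization of a smooth conic by projection from `p 0`, with a prescribed point `x` of the
conic at infinity. -/
theorem exists_parametrization {p : Fin 5 → Fin 3 → ℂ}
    (hcol : ∀ i j k : Fin 5, i ≠ j → i ≠ k → j ≠ k → LinearIndependent ℂ ![p i, p j, p k])
    {B : LinearMap.BilinForm ℂ (Fin 3 → ℂ)} (hB : ∀ u v, B u v = B v u)
    (hp : ∀ i, B (p i) (p i) = 0)
    (hline : ∀ u v, LinearIndependent ℂ ![u, v] → B u u = 0 → B v v = 0 → B u v ≠ 0)
    {x : Fin 3 → ℂ} (hx : B x x = 0) (hxp : ∀ i (a : ℂ), a • p i ≠ x) :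
    ∃ (γ : Fin 3 → Polynomial ℂ) (t c : Fin 5 → ℂ) (d : ℂ),
      (∀ j, (γ j).natDegree ≤ 2) ∧ d ≠ 0 ∧ (fun j => (γ j).coeff 2) = d • x ∧
      Function.Injective t ∧ (∀ i, c i ≠ 0) ∧ ∀ i j, (γ j).eval (t i) = c i * p i j := by
  have hpair : ∀ {i j}, i ≠ j → LinearIndependent ℂ ![p i, p j] :=
    linearIndependent_pair_of_triple hcol
  have hp0 : ∀ i, p i ≠ 0 := fun i => by
    obtain ⟨j, hj⟩ : ∃ j, i ≠ j := by revert i; decide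
    simpa using (hpair hj).ne_zero 0
  have hpx : ∀ i, B (p i) x ≠ 0 := fun i =>
    hline _ _ ((LinearIndependent.pair_iff' (hp0 i)).mpr (hxp i)) (hp i) hx
  have hpp : ∀ {i j}, i ≠ j → B (p i) (p j) ≠ 0 := fun h => hline _ _ (hpair h) (hp _) (hp _)
  have hx01 : LinearIndependent ℂ ![x, p 0, p 1] := by
    refine linearIndependent_finCons.mpr ⟨hpair (by decide), fun hmem => ?_⟩
    rw [Matrix.range_cons, Matrix.range_cons, Matrix.range_empty, Set.union_empty,
      Set.singleton_union, Submodule.mem_span_pair] at hmem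
    obtain ⟨a, b, rfl⟩ := hmem
    simp [hp, hB (p 1) (p 0)] at hx
    obtain rfl | rfl : a = 0 ∨ b = 0 := by
      have : 2 * B (p 0) (p 1) * (a * b) = 0 := by linear_combination hx
      simpa [hpp (show (0 : Fin 5) ≠ 1 by decide)] using this
    · exact hxp 1 b (by simp)
    · exact hxp 0 a (by simp)
  let b := basisOfLinearIndependentOfCardEqFinrank hx01 (by simp)
  have hb : ∀ v, ∃ α β δ : ℂ, v = α • p 0 + β • p 1 + δ • x := fun v => by
    refine ⟨b.coord 1 v, b.coord 2 v, b.coord 0 v, ?_⟩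
    conv_lhs => rw [← b.sum_repr v]
    simp [Fin.sum_univ_three, b]
    abel
  let γ : Fin 3 → Polynomial ℂ := fun j =>
    Polynomial.C (B (p 1) x * p 0 j) * Polynomial.X -
      (Polynomial.C (B (p 0) (p 1)) + Polynomial.C (B (p 0) x) * Polynomial.X) *
        (Polynomial.C (p 1 j) + Polynomial.C (x j) * Polynomial.X)
  have hγ : ∀ i, ∃ t c : ℂ, c ≠ 0 ∧ ∀ j, (γ j).eval t = c * p i j := by
    intro i
    by_cases hi : i = 0
    · subst hi
      have h01 := hpp (show (0 : Fin 5) ≠ 1 by decide)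
      refine ⟨-B (p 0) (p 1) / B (p 0) x, -B (p 0) (p 1) / B (p 0) x * B (p 1) x,
        mul_ne_zero (div_ne_zero (neg_ne_zero.mpr h01) (hpx 0)) (hpx 1), fun j => ?_⟩
      have := hpx 0
      simp [γ]
      field_simp
      ring
    · obtain ⟨α, β, δ, hv⟩ := hb (p i)
      have h0 : B (p 0) (p i) = β * B (p 0) (p 1) + δ * B (p 0) x := by
        rw [hv]; simp [hp]
      have hK := h0 ▸ hpp (Ne.symm hi)
      have hrel : α * β * B (p 0) (p 1) + α * δ * B (p 0) x + β * δ * B (p 1) x = 0 := by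
        have := hp i
        rw [hv] at this
        simp [hp, hx, hB (p 1) (p 0), hB x (p 0), hB x (p 1)] at this
        linear_combination this / 2
      have hβ : β ≠ 0 := by
        rintro rfl
        have : α * δ = 0 := by simpa [hpx 0] using hrel
        obtain rfl | rfl := mul_eq_zero.mp this
        · have hδ : δ ≠ 0 := by rintro rfl; exact hp0 i (by simpa using hv)
          exact hxp i δ⁻¹ (by rw [hv]; simp [smul_smul, hδ])
        · exact (LinearIndependent.pair_iff' (hp0 0)).mp (hpair (Ne.symm hi)) α (by rw [hv]; simp)
      refine ⟨δ / β, -(β * B (p 0) (p 1) + δ * B (p 0) x) / β ^ 2,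
        div_ne_zero (neg_ne_zero.mpr hK) (pow_ne_zero 2 hβ), fun j => ?_⟩
      have hvj : p i j = α * p 0 j + β * p 1 j + δ * x j := by
        simpa using congrFun hv j
      rw [hvj]
      simp [γ]
      field_simp
      linear_combination p 0 j * hrel
  choose t c hc hγt using hγ
  refine ⟨γ, t, c, -B (p 0) x, fun j => ?_, neg_ne_zero.mpr (hpx 0), ?_, ?_, hc, hγt⟩
  · simp only [γ]
    compute_degree
  · ext j
    have hγj : γ j = Polynomial.C (-B (p 0) x * x j) * Polynomial.X ^ 2 +
        Polynomial.C (B (p 1) x * p 0 j - B (p 0) x * p 1 j - B (p 0) (p 1) * x j) * Polynomial.X +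
        Polynomial.C (-B (p 0) (p 1) * p 1 j) := by
      simp only [γ, Polynomial.C_mul, Polynomial.C_sub, Polynomial.C_neg]
      ring
    simp [hγj, -map_mul]
  · intro i j hij
    by_contra hne
    refine (LinearIndependent.pair_iff' (hp0 i)).mp (hpair hne) ((c j)⁻¹ * c i) ?_
    ext s
    have := hγt i s
    rw [hij, hγt j s] at this
    simp [mul_assoc, ← this, hc j]

theorem dvd_of_forall_eval_eq_zero {q f : MvPolynomial (Fin 3) ℂ} (hq : Irreducible q)
    (h : ∀ x, eval x q = 0 → eval x f = 0) : q ∣ f := by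
  have : (Ideal.span {q}).IsPrime := (Ideal.span_singleton_prime hq.ne_zero).mpr hq.prime
  rw [← Ideal.mem_span_singleton, ← IsPrime.vanishingIdeal_zeroLocus (K := ℂ) (Ideal.span {q})]
  exact fun x hx => h x (hx q (Ideal.mem_span_singleton_self q))

/-- A form of degree `2k` with multiplicity `≥ k` at five points of a conic, no three collinear,
is a multiple of the `k`-th power of the conic. -/
theorem eq_C_mul_pow_of_X_pow_dvd_expandAt {p : Fin 5 → Fin 3 → ℂ}
    (hcol : ∀ i j k : Fin 5, i ≠ j → i ≠ k → j ≠ k → LinearIndependent ℂ ![p i, p j, p k])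
    {q : MvPolynomial (Fin 3) ℂ} (hq : q ≠ 0) (hq2 : q.IsHomogeneous 2)
    (hqv : ∀ i, eval (p i) q = 0) {k : ℕ} {f : MvPolynomial (Fin 3) ℂ}
    (hf : f.IsHomogeneous (2 * k)) (hmult : ∀ i, Polynomial.X ^ k ∣ expandAt (p i) f) :
    ∃ c : ℂ, f = C c * q ^ k := by
  obtain ⟨B, hB, hBq⟩ := exists_symm_bilin_of_isHomogeneous_two hq2
  have hp : ∀ i, B (p i) (p i) = 0 := fun i => by rw [← hBq, hqv]
  have hB0 : ∃ u, B u u ≠ 0 := by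
    by_contra! h
    exact hq (MvPolynomial.funext fun u => by rw [hBq, h, map_zero])
  have hline : ∀ u v, LinearIndependent ℂ ![u, v] → B u u = 0 → B v v = 0 → B u v ≠ 0 :=
    fun u v => bilin_ne_zero_of_linearIndependent hcol hB hp hB0
  induction k generalizing f with
  | zero =>
    refine ⟨coeff 0 f, ?_⟩
    rw [pow_zero, mul_one]
    exact totalDegree_eq_zero_iff_eq_C.mp ((totalDegree_zero_iff_isHomogeneous _).mpr hf)
  | succ k ih =>
    have hfp : ∀ i, eval (p i) f = 0 := fun i => by
      have h := Polynomial.X_pow_dvd_iff.mp (hmult i) 0 k.succ_pos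
      rwa [coeff_zero_expandAt, C_eq_zero] at h
    have hdvd : q ∣ f := by
      refine dvd_of_forall_eval_eq_zero (irreducible_conic hcol hq hq2 hqv) fun x hx => ?_
      by_cases hxp : ∃ i, ∃ a : ℂ, a • p i = x
      · obtain ⟨i, a, rfl⟩ := hxp
        rw [eval_smul_of_isHomogeneous_s9 hf, hfp, mul_zero]
      push Not at hxp
      obtain ⟨γ, t, c, d, hγ, hd, hγ2, ht, hc, hγt⟩ :=
        exists_parametrization hcol hB hp hline ((hBq x).symm.trans hx) hxp
      have h := eval_coeff_two_eq_zero k.succ_pos hf hγ ht fun i =>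
        X_sub_C_pow_dvd_aeval hf (hmult i) (hc i) (hγt i)
      rw [hγ2, eval_smul_of_isHomogeneous_s9 hf] at h
      exact (mul_eq_zero.mp h).resolve_left (pow_ne_zero _ hd)
    obtain ⟨g, rfl⟩ := hdvd
    have hg : g.IsHomogeneous (2 * k) := by
      refine isHomogeneous_of_mul hq hq2 ?_
      rwa [show 2 + 2 * k = 2 * (k + 1) by ring]
    obtain ⟨c, rfl⟩ := ih hg fun i => by
      obtain ⟨j, hij⟩ : ∃ j, i ≠ j := by revert i; decide
      have hsq := not_X_sq_dvd_expandAt hq2 hB hBq (hp i) (hp j)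
        (hline _ _ (linearIndependent_pair_of_triple hcol hij) (hp i) (hp j))
      have h := hmult i
      rw [map_mul] at h
      by_cases hX : Polynomial.X ∣ expandAt (p i) q
      · obtain ⟨r, hr⟩ := hX
        rw [hr, pow_succ', mul_assoc, mul_dvd_mul_iff_left Polynomial.X_ne_zero] at h
        refine Polynomial.prime_X.pow_dvd_of_dvd_mul_left k (fun hXr => hsq ?_) h
        rw [hr, pow_two]
        exact mul_dvd_mul_left _ hXr
      · exact (pow_dvd_pow _ k.le_succ).trans
          (Polynomial.prime_X.pow_dvd_of_dvd_mul_left (k + 1) hX h)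
    exact ⟨c, by rw [pow_succ]; ring⟩

/-- If five points of `ℙ²(ℂ)`, no three collinear, lie on the conic
`{q = 0}`, then every ternary sextic `g ≠ 0` with multiplicity `≥ 3` at all five points
is a nonzero multiple of `q³`. -/
theorem plane_sextic_with_five_triple_points
    (p : Fin 5 → (Fin 3 → ℂ)) (hp : ∀ i, p i ≠ 0)
    (hcol : ∀ i j k : Fin 5, i ≠ j → i ≠ k → j ≠ k →
      LinearIndependent ℂ ![p i, p j, p k])
    (q : MvPolynomial (Fin 3) ℂ) (hq : q ≠ 0) (hq2 : q.IsHomogeneous 2)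
    (hqv : ∀ i, MvPolynomial.eval (p i) q = 0)
    (g : MvPolynomial (Fin 3) ℂ) (hg : g ≠ 0) (hg6 : g.IsHomogeneous 6)
    (hmult : ∀ i, MultAtLeast g (p i) 3) :
    ∃ lam : ℂ, lam ≠ 0 ∧ g = MvPolynomial.C lam * q ^ 3 := by
  obtain ⟨c, rfl⟩ := eq_C_mul_pow_of_X_pow_dvd_expandAt hcol hq hq2 hqv (k := 3) hg6
    fun i => (hmult i).X_pow_dvd_expandAt
  exact ⟨c, fun hc => hg (by rw [hc, C_0, zero_mul]), rfl⟩
end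
end
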